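/- (Łojasiewicz gradient inequality, Lemma 1.5.) Let n ≥ 1 and let E : ℝⁿ → ℝ be real-analytic in a neighborhood of 0 with E(0) = 0 and ∇E(0) = 0. Then there exist θ ∈ (0, 1/2], C > 0 and r > 0 such that |E(x)|^{1−θ} ≤ C‖∇E(x)‖ for every x ∈ ℝⁿ with ‖x‖ < r. -/

import Mathlib

open Set
open Filter Topology

section Division

variable {V : Type*} [NormedAddCommGroup V] [NormedSpace ℝ V]

theorem FormalMultilinearSeries.sub_comp_eq_mul_sum_curryMid (p : FormalMultilinearSeries ℝ V ℝ)
    (P : V →L[ℝ] V) (ℓ : V →L[ℝ] ℝ) (e : V) (hP : ∀ x, x - P x = ℓ x • e) (n : ℕ) (x : V) :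
    (p (n + 1) fun _ => x) - (p (n + 1) fun _ => P x) =
      ℓ x * (∑ j : Fin (n + 1), ((p (n + 1)).compContinuousLinearMap
        fun i => if i < j then P else ContinuousLinearMap.id ℝ V).curryMid j e) fun _ => x := by
  set w : ℕ → Fin (n + 1) → V := fun j i => if (i : ℕ) < j then P x else x with hw
  have key : ∀ j : Fin (n + 1), p (n + 1) (w j) - p (n + 1) (w (j + 1)) =
      ℓ x * ((p (n + 1)).compContinuousLinearMap
        fun i => if i < j then P else ContinuousLinearMap.id ℝ V).curryMid j e fun _ => x := by
    intro j
    have h1 : w j = Function.update (w j) j x := by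
      ext i; by_cases h : i = j
      · subst h; simp [hw]
      · simp [h]
    have h2 : w (j + 1) = Function.update (w j) j (P x) := by
      ext i; by_cases h : i = j
      · subst h; simp [hw]
      · have : ((i : ℕ) < j + 1) ↔ (i : ℕ) < j := by
          have : (i : ℕ) ≠ j := fun h' => h (Fin.ext h')
          omega
        simp [h, hw, this]
    rw [h2]
    conv_lhs => rw [h1]
    rw [Function.update_idem, ← ContinuousMultilinearMap.map_update_sub, hP,
      ContinuousMultilinearMap.map_update_smul, smul_eq_mul,
      ContinuousMultilinearMap.curryMid_apply,
      ContinuousMultilinearMap.compContinuousLinearMap_apply]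
    refine congrArg _ (congrArg _ (funext fun i => ?_))
    rcases lt_trichotomy i j with h | h | h
    · have hne : i ≠ j := h.ne
      obtain ⟨k, rfl⟩ := Fin.exists_succAbove_eq hne
      rw [Function.update_of_ne hne]
      simp [hw, h]
    · subst h; simp
    · have hne : i ≠ j := h.ne'
      obtain ⟨k, rfl⟩ := Fin.exists_succAbove_eq hne
      rw [Function.update_of_ne hne]
      simp [hw, not_lt.2 h.le]
  have h0 : (fun _ => x) = w 0 := by ext i; simp [hw]
  have h1 : (fun _ => P x) = w (n + 1) := by ext i; simp only [hw, i.isLt, if_true]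
  rw [sum_apply, Finset.mul_sum, ← Finset.sum_congr rfl fun j _ => key j,
    Fin.sum_univ_eq_sum_range (fun j => p (n + 1) (w j) - p (n + 1) (w (j + 1))),
    Finset.sum_range_sub', ← h0, ← h1]

theorem AnalyticAt.exists_eq_comp_add_mul {f : V → ℝ} (hf : AnalyticAt ℝ f 0)
    (P : V →L[ℝ] V) (ℓ : V →L[ℝ] ℝ) (e : V) (hPn : ‖P‖ ≤ 1) (hP : ∀ x, x - P x = ℓ x • e) :
    ∃ h : V → ℝ, AnalyticAt ℝ h 0 ∧ ∀ᶠ x in 𝓝 0, f x = f (P x) + ℓ x * h x := by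
  obtain ⟨p, r, hp⟩ := hf
  set q : FormalMultilinearSeries ℝ V ℝ := fun n =>
    ∑ j : Fin (n + 1), ((p (n + 1)).compContinuousLinearMap
        fun i => if i < j then P else ContinuousLinearMap.id ℝ V).curryMid j e with hq
  have hqn : ∀ n, ‖q n‖ ≤ (n + 1) * (‖p (n + 1)‖ * ‖e‖) := by
    intro n
    refine (norm_sum_le _ _).trans ?_
    refine (Finset.sum_le_card_nsmul _ _ (‖p (n + 1)‖ * ‖e‖) fun j _ => ?_).trans (by simp)
    refine (ContinuousLinearMap.le_opNorm _ _).trans ?_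
    gcongr
    rw [ContinuousMultilinearMap.norm_curryMid]
    refine (ContinuousMultilinearMap.norm_compContinuousLinearMap_le _ _).trans ?_
    refine mul_le_of_le_one_right (norm_nonneg _) (Finset.prod_le_one (fun _ _ => norm_nonneg _) ?_)
    intro i _
    split_ifs
    exacts [hPn, ContinuousLinearMap.norm_id_le]
  obtain ⟨s, hs0, hsr⟩ := ENNReal.lt_iff_exists_nnreal_btwn.1 (hp.r_pos.trans_le hp.r_le)
  have hs0' : 0 < s := by exact_mod_cast hs0
  obtain ⟨C, hC0, hC⟩ := p.norm_mul_pow_le_of_lt_radius hsr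
  have hqr : 0 < q.radius := by
    refine lt_of_lt_of_le ?_ (q.le_radius_of_bound (r := s / 2) (C / s * ‖e‖) fun n => ?_)
    · simpa using hs0'.ne'
    have h1 := hC (n + 1)
    have h2 : ((n : ℝ) + 1) / 2 ^ n ≤ 1 := by
      rw [div_le_one (by positivity)]
      exact_mod_cast Nat.lt_two_pow_self (n := n)
    calc ‖q n‖ * ((s / 2 : NNReal) : ℝ) ^ n
        ≤ ((n + 1) * (‖p (n + 1)‖ * ‖e‖)) * ((s / 2 : NNReal) : ℝ) ^ n := by
          gcongr; exact hqn n
      _ = ((n : ℝ) + 1) / 2 ^ n * ((‖p (n + 1)‖ * (s : ℝ) ^ (n + 1)) / s * ‖e‖) := by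
          have : (s : ℝ) ≠ 0 := by exact_mod_cast hs0'.ne'
          push_cast
          rw [div_pow]
          field_simp
          ring
      _ ≤ 1 * (C / s * ‖e‖) := by gcongr
      _ = _ := one_mul _
  have hqs := q.hasFPowerSeriesOnBall hqr
  refine ⟨q.sum, hqs.analyticAt, ?_⟩
  have hP0 : Tendsto P (𝓝 0) (𝓝 0) := by simpa using P.continuous.tendsto 0
  filter_upwards [Metric.eball_mem_nhds (0 : V) hp.r_pos, hP0 (Metric.eball_mem_nhds (0 : V) hp.r_pos),
    Metric.eball_mem_nhds (0 : V) hqr] with x hx hPx hx'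
  have e1 := (hp.hasSum hx).sub (hp.hasSum hPx)
  simp only [zero_add] at e1
  have e2 := (hasSum_nat_add_iff' 1).2 e1
  have e3 := (hqs.hasSum hx').mul_left (ℓ x)
  simp only [zero_add] at e3
  have e4 : (fun n => ℓ x * q n fun _ => x) =
      fun n => (p (n + 1) fun _ => x) - (p (n + 1) fun _ => P x) := by
    ext n
    rw [p.sub_comp_eq_mul_sum_curryMid P ℓ e hP]
  rw [e4] at e3
  have := e2.unique e3
  simp only [Finset.range_one, Finset.sum_singleton] at this
  have h00 : (p 0 fun _ => x) = p 0 fun _ => P x := congrArg _ (Subsingleton.elim _ _)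
  rw [h00, sub_self, sub_zero] at this
  linarith

end Division

section Germs

variable {V : Type*} [NormedAddCommGroup V] [NormedSpace ℝ V]

theorem AnalyticAt.eventually_eq_zero_or_of_mul {f g : V → ℝ} {x₀ : V}
    (hf : AnalyticAt ℝ f x₀) (hg : AnalyticAt ℝ g x₀) (h : ∀ᶠ x in 𝓝 x₀, f x * g x = 0) :
    (∀ᶠ x in 𝓝 x₀, f x = 0) ∨ ∀ᶠ x in 𝓝 x₀, g x = 0 := by
  obtain ⟨r, hr, hball⟩ := Metric.eventually_nhds_iff_ball.1
    (hf.eventually_analyticAt.and (hg.eventually_analyticAt.and h))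
  by_cases hz : ∀ x ∈ Metric.ball x₀ r, f x = 0
  · exact .inl (Metric.eventually_nhds_iff_ball.2 ⟨r, hr, hz⟩)
  push Not at hz
  obtain ⟨p, hp, hfp⟩ := hz
  have hgp : g =ᶠ[𝓝 p] 0 := by
    filter_upwards [(hball p hp).1.continuousAt.eventually_ne hfp,
      Metric.isOpen_ball.mem_nhds hp] with x hx hxb
    exact (mul_eq_zero.1 (hball x hxb).2.2).resolve_left hx
  have hgU : AnalyticOnNhd ℝ g (Metric.ball x₀ r) := fun x hx => (hball x hx).2.1
  have := hgU.eqOn_zero_of_preconnected_of_eventuallyEq_zero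
    (convex_ball x₀ r).isPreconnected hp hgp
  exact .inr (Metric.eventually_nhds_iff_ball.2 ⟨r, hr, fun x hx => this hx⟩)

theorem AnalyticAt.eventuallyEq_of_mul_left_cancel {a f g : V → ℝ} {x₀ : V}
    (ha : AnalyticAt ℝ a x₀) (hf : AnalyticAt ℝ f x₀) (hg : AnalyticAt ℝ g x₀)
    (ha0 : ¬ ∀ᶠ x in 𝓝 x₀, a x = 0) (h : ∀ᶠ x in 𝓝 x₀, a x * f x = a x * g x) :
    f =ᶠ[𝓝 x₀] g := by
  have := (ha.eventually_eq_zero_or_of_mul (hf.sub hg) (by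
    filter_upwards [h] with x hx
    rw [Pi.sub_apply, mul_sub, hx, sub_self])).resolve_left ha0
  filter_upwards [this] with x hx
  exact sub_eq_zero.1 hx

theorem AnalyticAt.not_eventually_prod_eq_zero {ι : Type*} (s : Finset ι) {f : ι → V → ℝ} {x₀ : V}
    (hf : ∀ i ∈ s, AnalyticAt ℝ (f i) x₀) (h0 : ∀ i ∈ s, ¬ ∀ᶠ x in 𝓝 x₀, f i x = 0) :
    ¬ ∀ᶠ x in 𝓝 x₀, ∏ i ∈ s, f i x = 0 := by
  classical
  induction s using Finset.induction_on with
  | empty => simp [(NeBot.ne inferInstance : 𝓝 x₀ ≠ ⊥)]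
  | insert i s his ih =>
    intro h
    simp only [Finset.prod_insert his] at h
    have hs : ∀ j ∈ s, AnalyticAt ℝ (f j) x₀ := fun j hj => hf j (Finset.mem_insert_of_mem hj)
    rcases (hf i (Finset.mem_insert_self _ _)).eventually_eq_zero_or_of_mul
      (Finset.analyticAt_fun_prod s hs) h with h | h
    · exact h0 i (Finset.mem_insert_self _ _) h
    · exact ih hs (fun j hj => h0 j (Finset.mem_insert_of_mem hj)) h

end Germs

section Monomials

variable {n : ℕ}

/-- The monomial function `x ↦ x ^ α` on `ℝⁿ`. -/
def monomialFun (α : Fin n → ℕ) (x : Fin n → ℝ) : ℝ := ∏ i, x i ^ α i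

theorem analyticAt_monomialFun (α : Fin n → ℕ) (x : Fin n → ℝ) :
    AnalyticAt ℝ (monomialFun α) x := by
  refine Finset.analyticAt_fun_prod _ fun i _ => ?_
  exact ((ContinuousLinearMap.proj (R := ℝ) (φ := fun _ : Fin n => ℝ) i).analyticAt x).pow _

theorem analyticAt_coord (i : Fin n) (x : Fin n → ℝ) :
    AnalyticAt ℝ (fun x : Fin n → ℝ => x i) x :=
  (ContinuousLinearMap.proj (R := ℝ) (φ := fun _ : Fin n => ℝ) i).analyticAt x

theorem monomialFun_zero (x : Fin n → ℝ) : monomialFun 0 x = 1 := by simp [monomialFun]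

theorem monomialFun_add (α β : Fin n → ℕ) (x : Fin n → ℝ) :
    monomialFun (α + β) x = monomialFun α x * monomialFun β x := by
  simp [monomialFun, pow_add, Finset.prod_mul_distrib]

theorem monomialFun_nsmul (k : ℕ) (α : Fin n → ℕ) (x : Fin n → ℝ) :
    monomialFun (k • α) x = monomialFun α x ^ k := by
  simp [monomialFun, mul_comm k, pow_mul, Finset.prod_pow]

theorem monomialFun_single (i : Fin n) (x : Fin n → ℝ) : monomialFun (Pi.single i 1) x = x i := by
  rw [monomialFun, Finset.prod_eq_single i] <;> simp +contextual

theorem monomialFun_eq_zero {α : Fin n → ℕ} {i : Fin n} (hα : α i ≠ 0) {x : Fin n → ℝ}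
    (hx : x i = 0) : monomialFun α x = 0 :=
  Finset.prod_eq_zero (Finset.mem_univ i) (by rw [hx, zero_pow hα])

theorem not_eventually_coord_eq_zero (i : Fin n) : ¬ ∀ᶠ x : Fin n → ℝ in 𝓝 0, x i = 0 := by
  intro h
  have hc : Tendsto (fun t : ℝ => fun _ : Fin n => t) (𝓝[≠] 0) (𝓝 0) := by
    refine Tendsto.mono_left ?_ nhdsWithin_le_nhds
    exact (continuous_pi fun _ => continuous_id).tendsto' _ _ rfl
  have h2 : ∀ᶠ t : ℝ in 𝓝[≠] 0, t = 0 := hc.eventually h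
  obtain ⟨t, ht, ht'⟩ := (h2.and self_mem_nhdsWithin).exists
  exact ht' ht

theorem not_eventually_monomialFun_eq_zero (α : Fin n → ℕ) :
    ¬ ∀ᶠ x in 𝓝 0, monomialFun α x = 0 := by
  refine AnalyticAt.not_eventually_prod_eq_zero (f := fun i (x : Fin n → ℝ) => x i ^ α i) _
    (fun i _ => (analyticAt_coord i 0).pow _) fun i _ h => not_eventually_coord_eq_zero i ?_
  exact h.mono fun x hx => eq_zero_of_pow_eq_zero hx

/-- The projection of `ℝⁿ` to the coordinate hyperplane `x i = 0`. -/
def zeroCoord (i : Fin n) : (Fin n → ℝ) →L[ℝ] (Fin n → ℝ) :=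
  ContinuousLinearMap.pi fun j =>
    if j = i then 0 else ContinuousLinearMap.proj (R := ℝ) (φ := fun _ : Fin n => ℝ) j

theorem zeroCoord_apply (i : Fin n) (x : Fin n → ℝ) (j : Fin n) :
    zeroCoord i x j = if j = i then 0 else x j := by
  simp only [zeroCoord, ContinuousLinearMap.coe_pi']
  split_ifs <;> simp

theorem AnalyticAt.comp_zeroCoord {f : (Fin n → ℝ) → ℝ} (hf : AnalyticAt ℝ f 0) (i : Fin n) :
    AnalyticAt ℝ (fun x => f (zeroCoord i x)) 0 :=
  AnalyticAt.fun_comp (by simpa using hf) ((zeroCoord i).analyticAt 0)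

theorem tendsto_zeroCoord (i : Fin n) : Tendsto (zeroCoord i) (𝓝 0) (𝓝 0) := by
  simpa using (zeroCoord i).continuous.tendsto 0

theorem AnalyticAt.exists_eq_zeroCoord_add_mul {f : (Fin n → ℝ) → ℝ} (hf : AnalyticAt ℝ f 0)
    (i : Fin n) : ∃ h : (Fin n → ℝ) → ℝ, AnalyticAt ℝ h 0 ∧
      ∀ᶠ x in 𝓝 0, f x = f (zeroCoord i x) + x i * h x := by
  refine hf.exists_eq_comp_add_mul (zeroCoord i)
    (ContinuousLinearMap.proj (R := ℝ) (φ := fun _ : Fin n => ℝ) i) (Pi.single i 1) ?_ ?_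
  · refine ContinuousLinearMap.opNorm_le_bound _ zero_le_one fun x => ?_
    rw [one_mul]
    refine (pi_norm_le_iff_of_nonneg (norm_nonneg _)).2 fun j => ?_
    rw [zeroCoord_apply]
    split_ifs
    · simp
    · exact norm_le_pi_norm x j
  · intro x
    ext j
    by_cases h : j = i
    · subst h; simp [zeroCoord_apply]
    · simp [zeroCoord_apply, h]

/-- A germ at the origin of `ℝⁿ` is a normal crossing if it is a monomial times an analytic unit. -/
def IsNormalCrossing (f : (Fin n → ℝ) → ℝ) : Prop :=
  ∃ (α : Fin n → ℕ) (u : (Fin n → ℝ) → ℝ), AnalyticAt ℝ u 0 ∧ u 0 ≠ 0 ∧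
    ∀ᶠ x in 𝓝 0, f x = monomialFun α x * u x

namespace IsNormalCrossing

variable {f g : (Fin n → ℝ) → ℝ}

theorem congr (hf : IsNormalCrossing f) (h : g =ᶠ[𝓝 0] f) : IsNormalCrossing g := by
  obtain ⟨α, u, hu, hu0, hfu⟩ := hf
  exact ⟨α, u, hu, hu0, by filter_upwards [hfu, h] with x h1 h2; rw [h2, h1]⟩

theorem of_ne_zero (hf : AnalyticAt ℝ f 0) (h0 : f 0 ≠ 0) : IsNormalCrossing f :=
  ⟨0, f, hf, h0, by simp [monomialFun_zero]⟩

theorem coord (i : Fin n) : IsNormalCrossing fun x : Fin n → ℝ => x i :=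
  ⟨Pi.single i 1, fun _ => 1, analyticAt_const, one_ne_zero, by simp [monomialFun_single]⟩

theorem mul (hf : IsNormalCrossing f) (hg : IsNormalCrossing g) :
    IsNormalCrossing fun x => f x * g x := by
  obtain ⟨α, u, hu, hu0, hfu⟩ := hf
  obtain ⟨β, v, hv, hv0, hgv⟩ := hg
  refine ⟨α + β, fun x => u x * v x, hu.mul hv, mul_ne_zero hu0 hv0, ?_⟩
  filter_upwards [hfu, hgv] with x h1 h2
  rw [h1, h2, monomialFun_add]; ring

theorem pow (hf : IsNormalCrossing f) (k : ℕ) : IsNormalCrossing fun x => f x ^ k := by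
  obtain ⟨α, u, hu, hu0, hfu⟩ := hf
  refine ⟨k • α, fun x => u x ^ k, hu.pow k, pow_ne_zero _ hu0, ?_⟩
  filter_upwards [hfu] with x h1
  rw [h1, monomialFun_nsmul]; ring

theorem prod {ι : Type*} (s : Finset ι) {f : ι → (Fin n → ℝ) → ℝ}
    (hf : ∀ i ∈ s, IsNormalCrossing (f i)) : IsNormalCrossing fun x => ∏ i ∈ s, f i x := by
  classical
  induction s using Finset.induction_on with
  | empty => simpa using of_ne_zero (f := fun _ : Fin n → ℝ => (1 : ℝ)) analyticAt_const one_ne_zero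
  | insert i s his ih =>
    simp only [Finset.prod_insert his]
    exact (hf i (Finset.mem_insert_self _ _)).mul
      (ih fun j hj => hf j (Finset.mem_insert_of_mem hj))

theorem comp {m : ℕ} (hf : IsNormalCrossing f) {π : (Fin m → ℝ) → Fin n → ℝ}
    (hπ : AnalyticAt ℝ π 0) (hπ0 : π 0 = 0) (hc : ∀ i, IsNormalCrossing fun y => π y i) :
    IsNormalCrossing fun y => f (π y) := by
  obtain ⟨α, u, hu, hu0, hfu⟩ := hf
  have hu' : AnalyticAt ℝ (fun y => u (π y)) 0 := AnalyticAt.fun_comp (by rwa [hπ0]) hπ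
  have ht : Tendsto π (𝓝 0) (𝓝 0) := by simpa [hπ0] using hπ.continuousAt.tendsto
  refine ((prod Finset.univ fun i _ => (hc i).pow (α i)).mul
    (of_ne_zero hu' (by rwa [hπ0]))).congr ?_
  exact ht.eventually hfu

theorem not_eventually_eq_zero (hf : IsNormalCrossing f) : ¬ ∀ᶠ x in 𝓝 0, f x = 0 := by
  obtain ⟨α, u, hu, hu0, hfu⟩ := hf
  intro h
  refine not_eventually_monomialFun_eq_zero α ?_
  filter_upwards [h, hfu, hu.continuousAt.eventually_ne hu0] with x h1 h2 h3
  exact (mul_eq_zero.1 (h2.symm.trans h1)).resolve_right h3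

theorem of_mul (hf : AnalyticAt ℝ f 0) (hg : AnalyticAt ℝ g 0)
    (hfg : IsNormalCrossing fun x => f x * g x) : IsNormalCrossing f := by
  obtain ⟨α, u, hu, hu0, h⟩ := hfg
  induction hN : ∑ i, α i generalizing α f g with
  | zero =>
    have hα : α = 0 := by
      ext i; exact (Finset.sum_eq_zero_iff.1 hN) i (Finset.mem_univ i)
    subst hα
    have := h.self_of_nhds
    rw [monomialFun_zero, one_mul] at this
    exact of_ne_zero hf (left_ne_zero_of_mul (this ▸ hu0))
  | succ N ih =>
    obtain ⟨i, hi⟩ : ∃ i, α i ≠ 0 := by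
      by_contra! hc
      simp [hc] at hN
    set β : Fin n → ℕ := Function.update α i (α i - 1) with hβ
    have hαβ : α = Pi.single i 1 + β := by
      ext j
      by_cases hj : j = i
      · subst hj; simp [hβ]; omega
      · simp [hβ, hj]
    have hβN : ∑ i, β i = N := by
      rw [hαβ] at hN
      simp [Finset.sum_add_distrib] at hN
      omega
    have hcoord := analyticAt_coord i (0 : Fin n → ℝ)
    have key : ∀ {f' : (Fin n → ℝ) → ℝ}, AnalyticAt ℝ f' 0 →
        (∀ᶠ x in 𝓝 0, f' (zeroCoord i x) = 0) →
        ∃ f₁ : (Fin n → ℝ) → ℝ, AnalyticAt ℝ f₁ 0 ∧ ∀ᶠ x in 𝓝 0, f' x = x i * f₁ x := by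
      intro f' hf' h0
      obtain ⟨f₁, hf₁, h1⟩ := hf'.exists_eq_zeroCoord_add_mul i
      refine ⟨f₁, hf₁, ?_⟩
      filter_upwards [h0, h1] with x h0 h1
      rw [h1, h0, zero_add]
    have hcancel : ∀ {a : (Fin n → ℝ) → ℝ}, AnalyticAt ℝ a 0 →
        (∀ᶠ x in 𝓝 0, f x * g x = x i * a x) → ∀ᶠ x in 𝓝 0, a x = monomialFun β x * u x := by
      intro a ha hx
      refine hcoord.eventuallyEq_of_mul_left_cancel ha ((analyticAt_monomialFun β 0).mul hu)
        (not_eventually_coord_eq_zero i) ?_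
      filter_upwards [h, hx] with x h1 h2
      rw [← h2, h1, hαβ, monomialFun_add, monomialFun_single]; ring
    rcases (hf.comp_zeroCoord i).eventually_eq_zero_or_of_mul (hg.comp_zeroCoord i) (by
        filter_upwards [(tendsto_zeroCoord i).eventually h] with x hx
        rw [hx, monomialFun_eq_zero hi (by simp [zeroCoord_apply]), zero_mul]) with h0 | h0
    · obtain ⟨f₁, hf₁, h1⟩ := key hf h0
      have := ih hf₁ hg β (hcancel (hf₁.mul hg) (by
        filter_upwards [h1] with x hx; rw [hx, mul_assoc])) hβN
      exact ((coord i).mul this).congr h1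
    · obtain ⟨g₁, hg₁, h1⟩ := key hg h0
      exact ih hf hg₁ β (hcancel (hf.mul hg₁) (by
        filter_upwards [h1] with x hx; rw [hx]; ring)) hβN

theorem of_prod {ι : Type*} (s : Finset ι) {f : ι → (Fin n → ℝ) → ℝ}
    (hf : ∀ i ∈ s, AnalyticAt ℝ (f i) 0) (h : IsNormalCrossing fun x => ∏ i ∈ s, f i x)
    {i : ι} (hi : i ∈ s) : IsNormalCrossing (f i) := by
  classical
  refine of_mul (g := fun x => ∏ j ∈ s.erase i, f j x) (hf i hi)
    (Finset.analyticAt_fun_prod _ fun j hj => hf j (Finset.mem_of_mem_erase hj)) ?_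
  exact h.congr (.of_forall fun x => Finset.mul_prod_erase s (fun j => f j x) hi)

end IsNormalCrossing

theorem not_eventually_monomialFun_mul_comp_zeroCoord_eq {A B : Fin n → ℕ}
    {u v : (Fin n → ℝ) → ℝ} (hv : AnalyticAt ℝ v 0) (hv0 : v 0 ≠ 0) {i k : Fin n}
    (hAi : A i ≠ 0) (hBi : B i = 0) (hBk : B k = 0) :
    ¬ ∀ᶠ x in 𝓝 0, monomialFun A (zeroCoord k x) * u (zeroCoord k x) =
      monomialFun B (zeroCoord k x) * v (zeroCoord k x) := by
  intro h
  have hv' := (hv.comp_zeroCoord k).comp_zeroCoord i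
  refine IsNormalCrossing.not_eventually_eq_zero
    (f := fun x => monomialFun B x * v (zeroCoord k (zeroCoord i x)))
    ⟨B, _, hv', by simpa using hv0, by simp⟩ ?_
  filter_upwards [(tendsto_zeroCoord i).eventually h] with x hx
  rw [monomialFun_eq_zero hAi (by simp [zeroCoord_apply]), zero_mul] at hx
  rw [hx]
  congr 1
  refine Finset.prod_congr rfl fun j _ => ?_
  by_cases hj : j = i
  · subst hj; simp [hBi]
  by_cases hj' : j = k
  · subst hj'; simp [hBk]
  simp [zeroCoord_apply, hj, hj']

theorem le_or_le_of_monomialFun_sub {A B : Fin n → ℕ} {u v : (Fin n → ℝ) → ℝ}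
    (hu : AnalyticAt ℝ u 0) (hu0 : u 0 ≠ 0) (hv : AnalyticAt ℝ v 0) (hv0 : v 0 ≠ 0)
    (h : (∀ᶠ x in 𝓝 0, monomialFun A x * u x - monomialFun B x * v x = 0) ∨
      IsNormalCrossing fun x => monomialFun A x * u x - monomialFun B x * v x) :
    A ≤ B ∨ B ≤ A := by
  by_contra! hAB
  simp only [Pi.le_def, not_forall, not_le] at hAB
  obtain ⟨⟨i, hi⟩, j, hj⟩ := hAB
  set m := A ⊓ B with hm
  have hA : A = m + (A - m) := by ext l; simp [hm]
  have hB : B = m + (B - m) := by ext l; simp [hm]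
  set A' := A - m with hA'
  set B' := B - m with hB'
  have hA'i : A' i ≠ 0 := by simp [hA', hm]; omega
  have hB'i : B' i = 0 := by simp [hB', hm, hi.le]
  have hA'j : A' j = 0 := by simp [hA', hm, hj.le]
  have hB'j : B' j ≠ 0 := by simp [hB', hm]; omega
  set D : (Fin n → ℝ) → ℝ := fun x => monomialFun A' x * u x - monomialFun B' x * v x with hD
  have hDa : AnalyticAt ℝ D 0 :=
    ((analyticAt_monomialFun A' 0).mul hu).sub ((analyticAt_monomialFun B' 0).mul hv)
  have hfac : ∀ x, monomialFun A x * u x - monomialFun B x * v x = monomialFun m x * D x := by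
    intro x
    rw [hA, hB, monomialFun_add, monomialFun_add]
    simp only [hD]; ring
  simp only [hfac] at h
  have hD0 : D 0 = 0 := by
    simp [hD, monomialFun_eq_zero hA'i, monomialFun_eq_zero hB'j]
  obtain ⟨k, hk⟩ : ∃ k : Fin n, ∀ᶠ x in 𝓝 0, D (zeroCoord k x) = 0 := by
    rcases h with h | h
    · refine ⟨i, (tendsto_zeroCoord i).eventually (p := fun x => D x = 0) ?_⟩
      exact ((analyticAt_monomialFun m 0).eventually_eq_zero_or_of_mul hDa h).resolve_left
        (not_eventually_monomialFun_eq_zero m)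
    · simp only [mul_comm (monomialFun m _)] at h
      obtain ⟨C, w, hw, hw0, hDw⟩ := IsNormalCrossing.of_mul hDa (analyticAt_monomialFun m 0) h
      obtain ⟨k, hk⟩ : ∃ k, C k ≠ 0 := by
        by_contra! hc
        have hC : C = 0 := funext hc
        have := hDw.self_of_nhds
        rw [hC, monomialFun_zero, one_mul, hD0] at this
        exact hw0 this.symm
      refine ⟨k, ?_⟩
      filter_upwards [(tendsto_zeroCoord k).eventually hDw] with x hx
      rw [hx, monomialFun_eq_zero hk (by simp [zeroCoord_apply]), zero_mul]
  have hk' : A' k = 0 ∨ B' k = 0 := by simp [hA', hB', hm]; omega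
  rcases hk' with hk' | hk'
  · refine not_eventually_monomialFun_mul_comp_zeroCoord_eq (u := v) hu hu0 hB'j hA'j hk' ?_
    filter_upwards [hk] with x hx
    exact (sub_eq_zero.1 hx).symm
  · refine not_eventually_monomialFun_mul_comp_zeroCoord_eq (u := u) hv hv0 hA'i hB'i hk' ?_
    filter_upwards [hk] with x hx
    exact sub_eq_zero.1 hx

end Monomials

section Lifts

variable {n : ℕ}

/-- `π` is an analytic germ at the origin through which the ultrafilter `F` factors, a section
along `F` being given by `L`. -/
structure IsLift (F : Ultrafilter (Fin n → ℝ)) (π L : (Fin n → ℝ) → Fin n → ℝ) : Prop where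
  analyticAt : AnalyticAt ℝ π 0
  map_zero : π 0 = 0
  tendsto : Tendsto L F (𝓝 0)
  eventually_eq : ∀ᶠ x in F, π (L x) = x

namespace IsLift

variable {F : Ultrafilter (Fin n → ℝ)} {π L : (Fin n → ℝ) → Fin n → ℝ}

theorem map_le (h : IsLift F π L) : (F.map L : Filter (Fin n → ℝ)) ≤ 𝓝 0 := h.tendsto

theorem id (hF : (F : Filter (Fin n → ℝ)) ≤ 𝓝 0) : IsLift F (fun x => x) (fun x => x) :=
  ⟨analyticAt_id, rfl, hF, .of_forall fun _ => rfl⟩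

theorem comp (h : IsLift F π L) {π' L' : (Fin n → ℝ) → Fin n → ℝ}
    (h' : IsLift (F.map L) π' L') : IsLift F (fun y => π (π' y)) (fun x => L' (L x)) where
  analyticAt := AnalyticAt.fun_comp (by rw [h'.map_zero]; exact h.analyticAt) h'.analyticAt
  map_zero := by rw [h'.map_zero, h.map_zero]
  tendsto := h'.tendsto
  eventually_eq := by
    have := h'.eventually_eq
    rw [Ultrafilter.coe_map, eventually_map] at this
    filter_upwards [this, h.eventually_eq] with x h1 h2
    rw [h1, h2]

theorem tendsto_nhds (h : IsLift F π L) : Tendsto π (𝓝 0) (𝓝 0) := by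
  simpa [h.map_zero] using h.analyticAt.continuousAt.tendsto

theorem eventually_map (h : IsLift F π L) {q : (Fin n → ℝ) → Prop} (hq : ∀ᶠ x in F, q x) :
    ∀ᶠ y in F.map L, q (π y) := by
  rw [Ultrafilter.coe_map, Filter.eventually_map]
  filter_upwards [hq, h.eventually_eq] with x h1 h2
  rwa [h2]

end IsLift

theorem Ultrafilter.exists_tendsto_div {X : Type*} (F : Ultrafilter X) {f g : X → ℝ} {K : ℝ}
    (h : ∀ᶠ x in F, |f x| ≤ K * |g x|) :
    ∃ a, Tendsto (fun x => f x / g x) F (𝓝 a) ∧ ∀ᶠ x in F, g x = 0 → f x = 0 := by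
  have hmem : ∀ᶠ x in F, f x / g x ∈ Icc (-|K|) |K| := by
    filter_upwards [h] with x hx
    rw [mem_Icc, ← abs_le, abs_div]
    refine div_le_of_le_mul₀ (abs_nonneg _) (abs_nonneg _) (hx.trans ?_)
    gcongr
    exact le_abs_self K
  obtain ⟨a, -, ha⟩ := isCompact_Icc.ultrafilter_le_nhds (F.map fun x => f x / g x)
    (by rw [Ultrafilter.coe_map, le_principal_iff]; exact hmem)
  refine ⟨a, ha, ?_⟩
  filter_upwards [h] with x hx hg
  simpa [hg] using hx

theorem AnalyticAt.update {f : (Fin n → ℝ) → ℝ} {x : Fin n → ℝ} (hf : AnalyticAt ℝ f x)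
    (i : Fin n) : AnalyticAt ℝ (fun y => Function.update y i (f y)) x := by
  refine AnalyticAt.pi fun j => ?_
  by_cases h : j = i
  · subst h; simpa using hf
  · simpa [h] using analyticAt_coord j x

theorem isLift_update_mul_add {F : Ultrafilter (Fin n → ℝ)} (hF : (F : Filter (Fin n → ℝ)) ≤ 𝓝 0)
    {i : Fin n} {m : (Fin n → ℝ) → ℝ} (hm : AnalyticAt ℝ m 0) (hm0 : m 0 = 0)
    (hmi : ∀ y s, m (Function.update y i s) = m y) {a : ℝ}
    (ha : Tendsto (fun x => x i / m x) F (𝓝 a)) (h0 : ∀ᶠ x in F, m x = 0 → x i = 0) :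
    IsLift F (fun y => Function.update y i (m y * (y i + a)))
      (fun x => Function.update x i (x i / m x - a)) where
  analyticAt := (hm.mul ((analyticAt_coord i 0).add analyticAt_const)).update i
  map_zero := by simp [hm0]
  tendsto := by
    refine tendsto_pi_nhds.2 fun j => ?_
    by_cases h : j = i
    · subst h; simpa using ha.sub_const a
    · simp only [ne_eq, h, not_false_eq_true, Function.update_of_ne]
      exact ((continuous_apply j).tendsto (0 : Fin n → ℝ)).comp hF
  eventually_eq := by
    filter_upwards [h0] with x hx
    ext j
    by_cases h : j = i
    · subst h
      by_cases h1 : m x = 0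
      · simp [hmi, h1, hx h1]
      · simp [hmi, mul_div_cancel₀ _ h1]
    · simp [h]

theorem isNormalCrossing_update_mul_add {i : Fin n} {m : (Fin n → ℝ) → ℝ}
    (hm : IsNormalCrossing m) (a : ℝ) (j : Fin n) :
    IsNormalCrossing fun y => Function.update y i (m y * (y i + a)) j := by
  by_cases h : j = i
  · subst h
    simp only [Function.update_self]
    by_cases ha : a = 0
    · subst ha; simpa using hm.mul (.coord j)
    · exact hm.mul (.of_ne_zero ((analyticAt_coord j 0).add analyticAt_const) (by simpa using ha))
  · simpa [h] using IsNormalCrossing.coord j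

end Lifts

section Toric

variable {n : ℕ}

theorem exists_isLift_monomialFun_tail_eq_mul (β : Fin n → ℕ)
    (F : Ultrafilter (Fin (n + 1) → ℝ)) (hF : (F : Filter (Fin (n + 1) → ℝ)) ≤ 𝓝 0)
    (h : ∀ K : ℝ, ∀ᶠ x : Fin (n + 1) → ℝ in F, K * |monomialFun β (Fin.tail x)| < |x 0|) :
    ∃ π L, IsLift F π L ∧ (∀ i, IsNormalCrossing fun y => π y i) ∧
      ∃ q, AnalyticAt ℝ q 0 ∧ ∀ᶠ y in 𝓝 0, monomialFun β (Fin.tail (π y)) = π y 0 * q y := by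
  induction hN : ∑ i, β i generalizing β F with
  | zero =>
    exfalso
    have hβ : β = 0 := by
      ext i; exact (Finset.sum_eq_zero_iff.1 hN) i (Finset.mem_univ i)
    subst hβ
    have h1 : ∀ᶠ x : Fin (n + 1) → ℝ in F, |x 0| < 1 := by
      have hc : Continuous fun x : Fin (n + 1) → ℝ => |x 0| := by fun_prop
      exact hF ((hc.tendsto 0).eventually_lt_const (by simp))
    obtain ⟨x, h2, h3⟩ := (h1.and (h 1)).exists
    simp [monomialFun_zero] at h3
    linarith
  | succ N ih =>
    obtain ⟨i, hi⟩ : ∃ i, β i ≠ 0 := by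
      by_contra! hc
      simp [hc] at hN
    set β' : Fin n → ℕ := Function.update β i (β i - 1) with hβ'
    have hβ : β = Pi.single i 1 + β' := by
      ext j
      by_cases hj : j = i
      · subst hj; simp [hβ']; omega
      · simp [hβ', hj]
    have hβN : ∑ i, β' i = N := by
      rw [hβ] at hN
      simp [Finset.sum_add_distrib] at hN
      omega
    have hmul : ∀ y, monomialFun β y = y i * monomialFun β' y := fun y => by
      rw [hβ, monomialFun_add, monomialFun_single]
    by_cases hK : ∃ K : ℝ, ∀ᶠ x : Fin (n + 1) → ℝ in F, |x i.succ| ≤ K * |x 0|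
    · obtain ⟨K, hK⟩ := hK
      obtain ⟨a, ha, h0⟩ := F.exists_tendsto_div hK
      have hlift := isLift_update_mul_add hF (i := i.succ) (analyticAt_coord 0 0) rfl
        (fun y s => by simp [Function.update_of_ne (Fin.succ_ne_zero i).symm]) ha h0
      refine ⟨_, _, hlift, isNormalCrossing_update_mul_add (.coord 0) a,
        fun y => (y i.succ + a) * monomialFun β'
          (Fin.tail (Function.update y i.succ (y 0 * (y i.succ + a)))), ?_, .of_forall fun y => ?_⟩
      · refine ((analyticAt_coord _ _).add analyticAt_const).mul ?_
        refine AnalyticAt.fun_comp (analyticAt_monomialFun _ _) ?_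
        exact AnalyticAt.pi fun j => (analyticAt_pi_iff.1 hlift.analyticAt) j.succ
      · rw [hmul, ← mul_assoc]
        simp [Fin.tail, Function.update_of_ne (Fin.succ_ne_zero i).symm]
    · push Not at hK
      have ha : Tendsto (fun x : Fin (n + 1) → ℝ => x 0 / x i.succ) F (𝓝 0) := by
        rw [Metric.tendsto_nhds]
        intro ε hε
        filter_upwards [hK ε⁻¹] with x hx
        rw [dist_zero_right, Real.norm_eq_abs, abs_div]
        have : 0 < |x i.succ| := lt_of_le_of_lt (by positivity) hx
        rw [div_lt_iff₀ this]
        rwa [inv_mul_lt_iff₀ hε] at hx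
      have hxi : ∀ᶠ x : Fin (n + 1) → ℝ in F, x i.succ ≠ 0 := by
        filter_upwards [hK 0] with x hx
        simpa using hx
      have hlift := isLift_update_mul_add hF (i := 0) (analyticAt_coord i.succ 0) rfl
        (fun y s => by simp) ha (hxi.mono fun x h1 h2 => absurd h2 h1)
      obtain ⟨π, L, hπ, hnc, q, hq, hqe⟩ := ih β' (F.map _) hlift.map_le (fun K => by
        rw [Ultrafilter.coe_map, eventually_map]
        filter_upwards [h K, hxi] with x hx hxi
        rw [hmul, abs_mul] at hx
        rw [Fin.tail_update_zero, Function.update_self, sub_zero, abs_div]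
        rw [Fin.tail] at hx
        rw [lt_div_iff₀ (abs_pos.2 hxi)]
        linarith) hβN
      refine ⟨_, _, hlift.comp hπ, fun j => ?_, q, hq, ?_⟩
      · exact (isNormalCrossing_update_mul_add (i := 0) (.coord i.succ) 0 j).comp hπ.analyticAt
          hπ.map_zero hnc
      · filter_upwards [hqe] with y hy
        rw [hmul, Fin.tail_update_zero, hy, Function.update_self, Fin.tail]
        ring

theorem exists_isLift_monomialFun_tail_eq_mul_of_lt (β : Fin n → ℕ)
    (F : Ultrafilter (Fin (n + 1) → ℝ)) (hF : (F : Filter (Fin (n + 1) → ℝ)) ≤ 𝓝 0)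
    (h : ∀ K : ℝ, ∀ᶠ x : Fin (n + 1) → ℝ in F, K * |monomialFun β (Fin.tail x)| < |x 0|) :
    ∃ π L, IsLift F π L ∧ (∀ i, IsNormalCrossing fun y => π y i) ∧
      ∃ q, AnalyticAt ℝ q 0 ∧ q 0 = 0 ∧
        ∀ᶠ y in 𝓝 0, monomialFun β (Fin.tail (π y)) = π y 0 * q y := by
  obtain ⟨π, L, hπ, hnc, q, hq, hqe⟩ := exists_isLift_monomialFun_tail_eq_mul β F hF h
  refine ⟨π, L, hπ, hnc, q, hq, ?_, hqe⟩
  by_contra hq0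
  have h1 : ∀ᶠ y in F.map L, |q 0| / 2 < |q y| :=
    hπ.map_le (hq.continuousAt.abs.eventually_const_lt (half_lt_self (abs_pos.2 hq0)))
  have h2 : ∀ᶠ y in F.map L, monomialFun β (Fin.tail (π y)) = π y 0 * q y := hπ.map_le hqe
  obtain ⟨y, hy1, hy2, hy3⟩ := (h1.and (h2.and (hπ.eventually_map (h (|q 0| / 2)⁻¹)))).exists
  rw [hy2, abs_mul, inv_mul_lt_iff₀ (by positivity)] at hy3
  have := mul_le_mul_of_nonneg_left hy1.le (abs_nonneg (π y 0))
  linarith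

end Toric

section NewtonPreparation

variable {n : ℕ}

/-- Along every ultrafilter converging to the origin, every nonzero analytic germ in `n` variables
becomes a normal crossing after a suitable lift. -/
def Monomializable (n : ℕ) : Prop :=
  ∀ f : (Fin n → ℝ) → ℝ, AnalyticAt ℝ f 0 → (¬ ∀ᶠ x in 𝓝 0, f x = 0) →
    ∀ F : Ultrafilter (Fin n → ℝ), (F : Filter (Fin n → ℝ)) ≤ 𝓝 0 →
      ∃ π L, IsLift F π L ∧ IsNormalCrossing fun y => f (π y)

theorem Monomializable.exists_isLift_forall (hM : Monomializable n)
    (s : Finset ((Fin n → ℝ) → ℝ)) (hs : ∀ f ∈ s, AnalyticAt ℝ f 0)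
    (h0 : ∀ f ∈ s, ¬ ∀ᶠ x in 𝓝 0, f x = 0) {F : Ultrafilter (Fin n → ℝ)}
    (hF : (F : Filter (Fin n → ℝ)) ≤ 𝓝 0) :
    ∃ π L, IsLift F π L ∧ (∀ f ∈ s, IsNormalCrossing fun y => f (π y)) ∧
      ∀ i, IsNormalCrossing fun y => π y i := by
  have ha : AnalyticAt ℝ (fun x => ∏ f ∈ s, f x) 0 := Finset.analyticAt_fun_prod s hs
  have hb : AnalyticAt ℝ (fun x : Fin n → ℝ => ∏ i, x i) 0 :=
    Finset.analyticAt_fun_prod _ fun i _ => analyticAt_coord i 0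
  obtain ⟨π, L, hπ, hnc⟩ := hM (fun x => (∏ f ∈ s, f x) * ∏ i, x i) (ha.mul hb) (fun h => by
    rcases ha.eventually_eq_zero_or_of_mul hb h with h | h
    · exact AnalyticAt.not_eventually_prod_eq_zero s hs h0 h
    · exact AnalyticAt.not_eventually_prod_eq_zero _ (fun i _ => analyticAt_coord i 0)
        (fun i _ => not_eventually_coord_eq_zero i) h) F hF
  have hc : ∀ {f : (Fin n → ℝ) → ℝ}, AnalyticAt ℝ f 0 → AnalyticAt ℝ (fun y => f (π y)) 0 :=
    fun hf => AnalyticAt.fun_comp (by rwa [hπ.map_zero]) hπ.analyticAt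
  refine ⟨π, L, hπ, fun f hf => ?_, fun i => ?_⟩
  · exact IsNormalCrossing.of_prod (f := fun (f : (Fin n → ℝ) → ℝ) y => f (π y)) s
      (fun f hf => hc (hs f hf)) (hnc.of_mul (hc ha) (hc hb)) hf
  · refine IsNormalCrossing.of_prod (f := fun i y => π y i) Finset.univ
      (fun i _ => hc (analyticAt_coord i 0)) ?_ (Finset.mem_univ i)
    simp only [mul_comm (Finset.prod s _)] at hnc
    exact hnc.of_mul (hc hb) (hc ha)

theorem exists_isLift_pow {F : Ultrafilter (Fin n → ℝ)} (hF : (F : Filter (Fin n → ℝ)) ≤ 𝓝 0)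
    {N : ℕ} (hN : N ≠ 0) : ∃ (σ : Fin n → ℝ) (L : _), (∀ i, σ i ≠ 0) ∧
      IsLift F (fun y i => σ i * y i ^ N) L := by
  have h : ∀ i : Fin n, ∃ σ : ℝ, (σ = 1 ∨ σ = -1) ∧ ∀ᶠ x : Fin n → ℝ in F, 0 ≤ σ * x i := by
    intro i
    have : ∀ᶠ x : Fin n → ℝ in F, 0 ≤ x i ∨ x i ≤ 0 := .of_forall fun x => le_total _ _
    rcases Ultrafilter.eventually_or.1 this with h | h
    · exact ⟨1, .inl rfl, by simpa using h⟩
    · exact ⟨-1, .inr rfl, by simpa using h⟩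
  choose σ hσ hσF using h
  have hσ2 : ∀ i, σ i * σ i = 1 := fun i => by rcases hσ i with h | h <;> simp [h]
  refine ⟨σ, fun x i => (σ i * x i) ^ ((N : ℝ)⁻¹), fun i => left_ne_zero_of_mul (hσ2 i ▸ one_ne_zero),
    AnalyticAt.pi fun i => analyticAt_const.mul ((analyticAt_coord i 0).pow N), ?_, ?_, ?_⟩
  · ext i; simp [hN]
  · refine tendsto_pi_nhds.2 fun i => ?_
    have hc : Continuous fun x : Fin n → ℝ => (σ i * x i) ^ ((N : ℝ)⁻¹) :=
      (continuous_const.mul (continuous_apply i)).rpow_const fun _ => .inr (by positivity)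
    have := hc.tendsto 0
    simp only [Pi.zero_apply, mul_zero] at this
    rw [Real.zero_rpow (by positivity)] at this
    exact this.comp hF
  · filter_upwards [eventually_all.2 hσF] with x hx
    ext i
    rw [← Real.rpow_natCast, ← Real.rpow_mul (hx i), inv_mul_cancel₀ (by positivity),
      Real.rpow_one, ← mul_assoc, hσ2, one_mul]

theorem monomialFun_mul_pow (σ : Fin n → ℝ) (N : ℕ) (γ : Fin n → ℕ) (y : Fin n → ℝ) :
    monomialFun γ (fun i => σ i * y i ^ N) = monomialFun γ σ * monomialFun (N • γ) y := by
  simp [monomialFun, mul_pow, Finset.prod_mul_distrib, pow_mul]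

theorem monomialFun_ne_zero {σ : Fin n → ℝ} (hσ : ∀ i, σ i ≠ 0) (γ : Fin n → ℕ) :
    monomialFun γ σ ≠ 0 :=
  Finset.prod_ne_zero_iff.2 fun i _ => pow_ne_zero _ (hσ i)

theorem Monomializable.exists_isLift_eq_monomialFun_pow_mul (hM : Monomializable n)
    {F : Ultrafilter (Fin n → ℝ)} (hF : (F : Filter (Fin n → ℝ)) ≤ 𝓝 0) {s : Finset ℕ}
    {c : ℕ → (Fin n → ℝ) → ℝ} (hc : ∀ k ∈ s, AnalyticAt ℝ (c k) 0) (hc0 : ∀ k ∈ s, c k 0 = 0)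
    (hne : ∃ k ∈ s, ¬ ∀ᶠ x in 𝓝 0, c k x = 0) {w : ℕ → ℕ} (hw : ∀ k ∈ s, w k ≠ 0) :
    ∃ π L, IsLift F π L ∧ (∀ i, IsNormalCrossing fun y => π y i) ∧
      ∃ (β : Fin n → ℕ) (c' : ℕ → (Fin n → ℝ) → ℝ), β ≠ 0 ∧
        (∀ k ∈ s, AnalyticAt ℝ (c' k) 0) ∧
        (∀ k ∈ s, ∀ᶠ y in 𝓝 0, c k (π y) = monomialFun β y ^ w k * c' k y) ∧
        ∃ k ∈ s, c' k 0 ≠ 0 := by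
  classical
  set N : ℕ := ∏ k ∈ s, w k with hN
  have hN0 : N ≠ 0 := Finset.prod_ne_zero_iff.2 hw
  set p : ℕ → ℕ := fun k => N / w k with hp
  have hpw : ∀ k ∈ s, w k * p k = N := fun k hk => Nat.mul_div_cancel' (Finset.dvd_prod_of_mem w hk)
  set S := s.filter fun k => ¬ ∀ᶠ x in 𝓝 0, c k x = 0 with hS
  set D : ℕ × ℕ → (Fin n → ℝ) → ℝ := fun q x => c q.1 x ^ p q.1 - c q.2 x ^ p q.2 with hD
  have hSs : ∀ k ∈ S, k ∈ s := fun k hk => (Finset.mem_filter.1 hk).1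
  obtain ⟨π, L, hπ, hnc, hcoord⟩ := hM.exists_isLift_forall
    (S.image c ∪ ((S ×ˢ S).filter fun q => ¬ ∀ᶠ x in 𝓝 0, D q x = 0).image D)
    (by
      intro f hf
      rcases Finset.mem_union.1 hf with hf | hf
      · obtain ⟨k, hk, rfl⟩ := Finset.mem_image.1 hf
        exact hc k (hSs k hk)
      · obtain ⟨q, hq, rfl⟩ := Finset.mem_image.1 hf
        have := Finset.mem_product.1 (Finset.mem_filter.1 hq).1
        exact ((hc _ (hSs _ this.1)).pow _).sub ((hc _ (hSs _ this.2)).pow _))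
    (by
      intro f hf
      rcases Finset.mem_union.1 hf with hf | hf
      · obtain ⟨k, hk, rfl⟩ := Finset.mem_image.1 hf
        exact (Finset.mem_filter.1 hk).2
      · obtain ⟨q, hq, rfl⟩ := Finset.mem_image.1 hf
        exact (Finset.mem_filter.1 hq).2) hF
  have hnc1 : ∀ k : ℕ, ∃ (γ : Fin n → ℕ) (u : (Fin n → ℝ) → ℝ), k ∈ S →
      AnalyticAt ℝ u 0 ∧ u 0 ≠ 0 ∧ ∀ᶠ y in 𝓝 0, c k (π y) = monomialFun γ y * u y := by
    intro k
    by_cases hk : k ∈ S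
    · obtain ⟨γ, u, h⟩ := hnc (c k) (Finset.mem_union_left _ (Finset.mem_image_of_mem c hk))
      exact ⟨γ, u, fun _ => h⟩
    · exact ⟨0, 0, fun h => absurd h hk⟩
  choose γ u hγu using hnc1
  have hcmp : ∀ j ∈ S, ∀ k ∈ S, p j • γ j ≤ p k • γ k ∨ p k • γ k ≤ p j • γ j := by
    intro j hj k hk
    obtain ⟨hu, hu0, hcu⟩ := hγu j hj
    obtain ⟨hv, hv0, hcv⟩ := hγu k hk
    have hDe : (fun y => monomialFun (p j • γ j) y * u j y ^ p j -
        monomialFun (p k • γ k) y * u k y ^ p k) =ᶠ[𝓝 0] fun y => D (j, k) (π y) := by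
      filter_upwards [hcu, hcv] with y h1 h2
      simp only [hD]
      rw [h1, h2, monomialFun_nsmul, monomialFun_nsmul]; ring
    refine le_or_le_of_monomialFun_sub (hu.pow (p j)) (pow_ne_zero _ hu0) (hv.pow (p k))
      (pow_ne_zero _ hv0) ?_
    by_cases hz : ∀ᶠ x in 𝓝 0, D (j, k) x = 0
    · left
      filter_upwards [hDe, hπ.tendsto_nhds.eventually hz] with y h1 h2
      exact h1.trans h2
    · right
      refine (hnc (D (j, k)) (Finset.mem_union_right _ (Finset.mem_image_of_mem D ?_))).congr hDe
      exact Finset.mem_filter.2 ⟨Finset.mem_product.2 ⟨hj, hk⟩, hz⟩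
  obtain ⟨k₀, hk₀, hmin⟩ := S.exists_min_image (fun k => ∑ i, (p k • γ k) i) (by
    obtain ⟨k, hk, hk'⟩ := hne
    exact ⟨k, Finset.mem_filter.2 ⟨hk, hk'⟩⟩)
  set β := p k₀ • γ k₀ with hβ
  have hle : ∀ k ∈ S, β ≤ p k • γ k := by
    intro k hk
    rcases hcmp k₀ hk₀ k hk with h | h
    · exact h
    · have h1 := (Finset.sum_eq_sum_iff_of_le fun i _ => h i).1
        ((Finset.sum_le_sum fun i _ => h i).antisymm (hmin k hk))
      exact fun i => (h1 i (Finset.mem_univ i)).ge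
  obtain ⟨σ, L', hσ, hσL⟩ := exists_isLift_pow hπ.map_le hN0
  set π' : (Fin n → ℝ) → Fin n → ℝ := fun y i => σ i * y i ^ N with hπ'
  have hpc : ∀ i, IsNormalCrossing fun y => π' y i := fun i =>
    (IsNormalCrossing.of_ne_zero analyticAt_const (hσ i)).mul ((IsNormalCrossing.coord i).pow N)
  set c' : ℕ → (Fin n → ℝ) → ℝ := fun k y => if k ∈ S then
    monomialFun (γ k) σ * monomialFun (w k • (p k • γ k - β)) y * u k (π' y) else 0 with hc'
  have hce : ∀ k ∈ s, ∀ᶠ y in 𝓝 0, c k (π (π' y)) = monomialFun β y ^ w k * c' k y := by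
    intro k hk
    by_cases hkS : k ∈ S
    · filter_upwards [hσL.tendsto_nhds.eventually (hγu k hkS).2.2] with y hy
      rw [hy, hπ', monomialFun_mul_pow, ← hpw k hk]
      simp only [hc', hkS, if_true]
      have : (w k * p k) • γ k = w k • β + w k • (p k • γ k - β) := by
        rw [← smul_add, add_tsub_cancel_of_le (hle k hkS), mul_smul]
      rw [this, monomialFun_add, monomialFun_nsmul (w k) β, hπ', ← hpw k hk]
      ring
    · have hz : ∀ᶠ x in 𝓝 0, c k x = 0 := by
        by_contra h
        exact hkS (Finset.mem_filter.2 ⟨hk, h⟩)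
      filter_upwards [hσL.tendsto_nhds.eventually (hπ.tendsto_nhds.eventually hz)] with y hy
      simp [hy, hc', hkS]
  have hk₀0 : c' k₀ 0 ≠ 0 := by
    simp only [hc', hk₀, if_true, hβ, tsub_self, smul_zero, monomialFun_zero, mul_one]
    rw [hσL.map_zero]
    exact mul_ne_zero (monomialFun_ne_zero hσ _) (hγu k₀ hk₀).2.1
  refine ⟨_, _, hπ.comp hσL, fun i => (hcoord i).comp hσL.analyticAt hσL.map_zero hpc, β, c', ?_,
    fun k hk => ?_, hce, k₀, hSs _ hk₀, hk₀0⟩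
  · intro h0
    have := (hce k₀ (hSs _ hk₀)).self_of_nhds
    rw [hσL.map_zero, hπ.map_zero, hc0 _ (hSs _ hk₀), h0, monomialFun_zero, one_pow, one_mul] at this
    exact hk₀0 this.symm
  · by_cases hkS : k ∈ S
    · simp only [hc', hkS, if_true]
      refine (analyticAt_const.mul (analyticAt_monomialFun _ _)).mul ?_
      exact AnalyticAt.fun_comp (by rw [hσL.map_zero]; exact (hγu k hkS).1) hσL.analyticAt
    · simp only [hc', hkS, if_false]
      exact analyticAt_const

end NewtonPreparation

section Tschirnhaus

variable {n : ℕ}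

theorem AnalyticAt.finCons {V : Type*} [NormedAddCommGroup V] [NormedSpace ℝ V] {f : V → ℝ}
    {g : V → Fin n → ℝ} {x : V} (hf : AnalyticAt ℝ f x) (hg : AnalyticAt ℝ g x) :
    AnalyticAt ℝ (fun y => (Fin.cons (f y) (g y) : Fin (n + 1) → ℝ)) x := by
  refine AnalyticAt.pi fun i => ?_
  refine Fin.cases ?_ (fun i => ?_) i
  · simpa using hf
  · simpa using (analyticAt_pi_iff.1 hg) i

theorem AnalyticAt.finTail {V : Type*} [NormedAddCommGroup V] [NormedSpace ℝ V]
    {g : V → Fin (n + 1) → ℝ} {x : V} (hg : AnalyticAt ℝ g x) :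
    AnalyticAt ℝ (fun y => Fin.tail (g y)) x :=
  AnalyticAt.pi fun i => (analyticAt_pi_iff.1 hg) i.succ

theorem finCons_zero_zero : (Fin.cons (0 : ℝ) (0 : Fin n → ℝ) : Fin (n + 1) → ℝ) = 0 := by
  ext i
  refine Fin.cases ?_ (fun i => ?_) i <;> simp

theorem finTail_zero : Fin.tail (0 : Fin (n + 1) → ℝ) = 0 := rfl

theorem zeroCoord_zero_eq_cons (x : Fin (n + 1) → ℝ) :
    zeroCoord 0 x = (Fin.cons 0 (Fin.tail x) : Fin (n + 1) → ℝ) := by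
  ext i
  refine Fin.cases ?_ (fun i => ?_) i <;> simp [zeroCoord_apply, Fin.tail]

theorem AnalyticAt.exists_eq_sum_tail_mul_pow {g : (Fin (n + 1) → ℝ) → ℝ}
    (hg : AnalyticAt ℝ g 0) (d : ℕ) :
    ∃ (a : ℕ → (Fin n → ℝ) → ℝ) (h : (Fin (n + 1) → ℝ) → ℝ), (∀ k, AnalyticAt ℝ (a k) 0) ∧
      AnalyticAt ℝ h 0 ∧ ∀ᶠ x in 𝓝 0,
        g x = ∑ k ∈ Finset.range d, a k (Fin.tail x) * x 0 ^ k + x 0 ^ d * h x := by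
  induction d with
  | zero => exact ⟨fun _ _ => 0, g, fun _ => analyticAt_const, hg, by simp⟩
  | succ d ih =>
    obtain ⟨a, h, ha, hh, hgh⟩ := ih
    obtain ⟨h', hh', hhh'⟩ := hh.exists_eq_zeroCoord_add_mul 0
    refine ⟨Function.update a d fun x => h (Fin.cons 0 x), h', fun k => ?_, hh', ?_⟩
    · by_cases hk : k = d
      · subst hk
        rw [Function.update_self]
        exact AnalyticAt.fun_comp (by rwa [finCons_zero_zero])
          (analyticAt_const.finCons analyticAt_id)
      · rw [Function.update_of_ne hk]
        exact ha k
    · filter_upwards [hgh, hhh'] with x h1 h2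
      rw [h1, h2, Finset.sum_range_succ, Function.update_self, zeroCoord_zero_eq_cons]
      have : ∀ k ∈ Finset.range d, Function.update a d (fun x => h (Fin.cons 0 x)) k (Fin.tail x) *
          x 0 ^ k = a k (Fin.tail x) * x 0 ^ k := fun k hk => by
        rw [Function.update_of_ne (Finset.mem_range.1 hk).ne]
      rw [Finset.sum_congr rfl this]
      ring

theorem iteratedDeriv_eq_of_eventuallyEq_sum {f H : ℝ → ℝ} {b : ℕ → ℝ} {d : ℕ}
    (hH : AnalyticAt ℝ H 0)
    (h : ∀ᶠ t in 𝓝 0, f t = ∑ k ∈ Finset.range d, b k * t ^ k + t ^ d * H t) {j : ℕ} (hj : j < d) :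
    iteratedDeriv j f 0 = j.factorial * b j := by
  have e : f =ᶠ[𝓝 0] fun t => ∑ k ∈ Finset.range d, b k * t ^ k + t ^ d * H t := h
  rw [e.iteratedDeriv_eq]
  have ht : AnalyticAt ℝ (fun t : ℝ => t ^ d * H t) 0 := (analyticAt_id.pow d).mul hH
  have h1 : iteratedDeriv j (fun t : ℝ => t ^ d * H t) 0 = 0 := by
    refine (natCast_le_analyticOrderAt_iff_iteratedDeriv_eq_zero ht).1 ?_ j hj
    exact (natCast_le_analyticOrderAt ht).2 ⟨H, hH, by simp⟩
  have h2 : AnalyticAt ℝ (fun t : ℝ => ∑ k ∈ Finset.range d, b k * t ^ k) 0 :=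
    Finset.analyticAt_fun_sum _ fun i hi => by fun_prop
  rw [iteratedDeriv_fun_add h2.contDiffAt ht.contDiffAt, h1, add_zero,
    iteratedDeriv_fun_sum fun i hi => AnalyticAt.contDiffAt (by fun_prop)]
  simp only [iteratedDeriv_const_mul_field, iteratedDeriv_fun_pow_zero]
  rw [Finset.sum_eq_single j]
  · simp [mul_comm]
  · intro k _ hk
    simp [hk.symm]
  · simp [hj]

theorem exists_analyticAt_implicit {A : (Fin (n + 1) → ℝ) → ℝ} (hA : AnalyticAt ℝ A 0)
    (hA0 : A 0 = 0) (hd : deriv (fun s : ℝ => A (Fin.cons s 0)) 0 ≠ 0) :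
    ∃ φ : (Fin n → ℝ) → ℝ, AnalyticAt ℝ φ 0 ∧ φ 0 = 0 ∧
      ∀ᶠ x in 𝓝 0, A (Fin.cons (φ x) x) = 0 := by
  set f : (Fin n → ℝ) × ℝ → ℝ := fun p => A (Fin.cons p.2 p.1) with hf
  have hfa : AnalyticAt ℝ f (0, 0) :=
    AnalyticAt.fun_comp (by rwa [finCons_zero_zero]) (analyticAt_snd.finCons analyticAt_fst)
  have hfc : ContDiffAt ℝ ⊤ f (0, 0) := hfa.contDiffAt
  set ℓ := fderiv ℝ f (0, 0) ∘L .inr ℝ (Fin n → ℝ) ℝ with hℓ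
  have hℓ1 : ℓ 1 ≠ 0 := by
    have h1 : HasDerivAt (fun s : ℝ => f (0, s)) (ℓ 1) 0 := by
      have h2 : HasFDerivAt f (fderiv ℝ f (0, 0)) (0, 0) := hfa.differentiableAt.hasFDerivAt
      have h3 : HasFDerivAt (fun s : ℝ => ((0 : Fin n → ℝ), s)) (.inr ℝ (Fin n → ℝ) ℝ) 0 :=
        hasFDerivAt_prodMk_right _ _
      exact (h2.comp (0 : ℝ) h3).hasDerivAt
    rw [← h1.deriv]
    exact hd
  have hinv : ℓ.IsInvertible := by
    refine ⟨ContinuousLinearEquiv.equivOfInverse ℓ ((ℓ 1)⁻¹ • .id ℝ ℝ) (fun s => ?_) fun s => ?_, rfl⟩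
    · have : ℓ s = s * ℓ 1 := by simpa using ℓ.map_smul s 1
      simp only [smul_apply, ContinuousLinearMap.id_apply, smul_eq_mul]
      rw [this]; field_simp
    · have : ∀ s, ℓ s = s * ℓ 1 := fun s => by simpa using ℓ.map_smul s 1
      rw [this]
      simp only [smul_apply, ContinuousLinearMap.id_apply, smul_eq_mul]
      field_simp
  have ht : (⊤ : WithTop ℕ∞) ≠ 0 := by simp
  refine ⟨hfc.implicitFunction ht hinv, ?_, hfc.implicitFunction_apply_self ht hinv, ?_⟩
  · have := hfc.contDiffAt_implicitFunction ht hinv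
    exact this.analyticAt
  · have := hfc.eventually_apply_implicitFunction ht hinv
    have h00 : f (0, 0) = 0 := by simp [hf, finCons_zero_zero, hA0]
    rw [h00] at this
    exact this

theorem AnalyticAt.exists_tschirnhaus {g : (Fin (n + 1) → ℝ) → ℝ} (hg : AnalyticAt ℝ g 0) {e : ℕ}
    (he : analyticOrderAt (fun t : ℝ => g (Fin.cons t 0)) 0 = (e + 1 : ℕ)) :
    ∃ (φ : (Fin n → ℝ) → ℝ) (c : ℕ → (Fin n → ℝ) → ℝ) (h : (Fin (n + 1) → ℝ) → ℝ),
      AnalyticAt ℝ φ 0 ∧ φ 0 = 0 ∧ (∀ k, AnalyticAt ℝ (c k) 0) ∧ (∀ k < e, c k 0 = 0) ∧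
      AnalyticAt ℝ h 0 ∧ h 0 ≠ 0 ∧ ∀ᶠ x in 𝓝 0,
        g (Fin.cons (x 0 + φ (Fin.tail x)) (Fin.tail x)) =
          ∑ k ∈ Finset.range e, c k (Fin.tail x) * x 0 ^ k + x 0 ^ (e + 1) * h x := by
  set f : ℝ → ℝ := fun t => g (Fin.cons t 0) with hf
  have hfa : AnalyticAt ℝ f 0 := AnalyticAt.fun_comp (by rwa [finCons_zero_zero])
    (analyticAt_id.finCons analyticAt_const)
  set G : (Fin (n + 1 + 1) → ℝ) → ℝ := fun x =>
    g (Fin.cons (x 0 + x 1) (Fin.tail (Fin.tail x))) with hG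
  have hGa : AnalyticAt ℝ G 0 := by
    refine AnalyticAt.fun_comp ?_ (((analyticAt_coord 0 0).add (analyticAt_coord 1 0)).finCons
      analyticAt_id.finTail.finTail)
    simpa [finTail_zero, finCons_zero_zero] using hg
  obtain ⟨A, H, hA, hH, hGAH⟩ := hGa.exists_eq_sum_tail_mul_pow (e + 1 + 1)
  have hcont : Tendsto (fun s : ℝ => (Fin.cons 0 (Fin.cons s 0) : Fin (n + 1 + 1) → ℝ))
      (𝓝 0) (𝓝 0) := by
    have : AnalyticAt ℝ (fun s : ℝ => (Fin.cons 0 (Fin.cons s (0 : Fin n → ℝ) : Fin (n + 1) → ℝ) :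
        Fin (n + 1 + 1) → ℝ)) 0 :=
      analyticAt_const.finCons (analyticAt_id.finCons analyticAt_const)
    simpa [finCons_zero_zero] using this.continuousAt.tendsto
  have hcoef : ∀ᶠ s : ℝ in 𝓝 0, ∀ j < e + 1 + 1,
      iteratedDeriv j f s = j.factorial * A j (Fin.cons s 0) := by
    filter_upwards [hcont.eventually hGAH.eventually_nhds,
      hcont.eventually hH.eventually_analyticAt] with s h1 h2 j hj
    have hpath : AnalyticAt ℝ (fun t : ℝ =>
        (Fin.cons t (Fin.cons s (0 : Fin n → ℝ) : Fin (n + 1) → ℝ) : Fin (n + 1 + 1) → ℝ)) 0 :=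
      analyticAt_id.finCons analyticAt_const
    have h3 := iteratedDeriv_eq_of_eventuallyEq_sum (f := fun t => f (t + s))
      (H := fun t => H (Fin.cons t (Fin.cons s 0))) (b := fun k => A k (Fin.cons s 0))
      (AnalyticAt.fun_comp h2 hpath) (by
        filter_upwards [hpath.continuousAt.tendsto.eventually h1] with t ht
        simpa [hG, hf, Fin.tail_cons] using ht) hj
    rw [iteratedDeriv_comp_add_const] at h3
    simpa using h3
  have hord := (analyticOrderAt_eq_nat_iff_iteratedDeriv_eq_zero hfa).1 he
  have hcoef0 : ∀ j < e + 1 + 1, iteratedDeriv j f 0 = j.factorial * A j 0 := by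
    simpa [finCons_zero_zero] using hcoef.self_of_nhds
  have hA0 : ∀ j < e + 1, A j 0 = 0 := by
    intro j hj
    have := hcoef0 j (by omega)
    rw [hord.1 j hj] at this
    simpa [Nat.factorial_ne_zero] using this.symm
  have hAe : A (e + 1) 0 ≠ 0 := by
    intro h
    have := hcoef0 (e + 1) (by omega)
    rw [h, mul_zero] at this
    exact hord.2 this
  obtain ⟨φ, hφ, hφ0, hφA⟩ := exists_analyticAt_implicit (hA e) (hA0 e (by omega)) (by
    have h1 : iteratedDeriv e f =ᶠ[𝓝 0] fun s => e.factorial * A e (Fin.cons s 0) := by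
      filter_upwards [hcoef] with s hs using hs e (by omega)
    have h2 := h1.deriv_eq
    rw [← iteratedDeriv_succ, deriv_const_mul_field] at h2
    intro h
    rw [h, mul_zero] at h2
    exact hord.2 h2)
  have hcons : AnalyticAt ℝ (fun x => (Fin.cons (φ x) x : Fin (n + 1) → ℝ)) 0 :=
    hφ.finCons analyticAt_id
  have htaila : AnalyticAt ℝ (fun x : Fin (n + 1) → ℝ => Fin.tail x) 0 := analyticAt_id.finTail
  have hcons' : AnalyticAt ℝ (fun x : Fin (n + 1) → ℝ =>
      (Fin.cons (φ (Fin.tail x)) (Fin.tail x) : Fin (n + 1) → ℝ)) 0 :=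
    (AnalyticAt.fun_comp (by rwa [finTail_zero]) htaila).finCons htaila
  have hcons'' : AnalyticAt ℝ (fun x : Fin (n + 1) → ℝ =>
      (Fin.cons (x 0) (Fin.cons (φ (Fin.tail x)) (Fin.tail x) : Fin (n + 1) → ℝ) :
        Fin (n + 1 + 1) → ℝ)) 0 := (analyticAt_coord 0 0).finCons hcons'
  have htail : Tendsto (fun x : Fin (n + 1) → ℝ => Fin.tail x) (𝓝 0) (𝓝 0) :=
    htaila.continuousAt.tendsto
  refine ⟨φ, fun k x => A k (Fin.cons (φ x) x), fun x => A (e + 1) (Fin.cons (φ (Fin.tail x))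
    (Fin.tail x)) + x 0 * H (Fin.cons (x 0) (Fin.cons (φ (Fin.tail x)) (Fin.tail x))), hφ, hφ0,
    fun k => AnalyticAt.fun_comp ?_ hcons, fun k hk => ?_, ?_, ?_, ?_⟩
  · simpa [hφ0, finCons_zero_zero] using hA k
  · simpa [hφ0, finCons_zero_zero] using hA0 k (by omega)
  · refine (AnalyticAt.fun_comp ?_ hcons').add
      ((analyticAt_coord 0 0).mul (AnalyticAt.fun_comp ?_ hcons''))
    · simpa [hφ0, finCons_zero_zero, finTail_zero] using hA (e + 1)
    · simpa [hφ0, finCons_zero_zero, finTail_zero] using hH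
  · simpa [hφ0, finCons_zero_zero, finTail_zero] using hAe
  · have ht := hcons''.continuousAt.tendsto
    simp only [hφ0, finCons_zero_zero, finTail_zero, Pi.zero_apply] at ht
    filter_upwards [ht.eventually hGAH, htail.eventually hφA] with x h1 h2
    simp only [hG, Fin.cons_zero, Fin.cons_one, Fin.tail_cons] at h1
    rw [h1, Finset.sum_range_succ, Finset.sum_range_succ, h2]
    ring

end Tschirnhaus

section Regular

variable {n : ℕ}

/-- `g` becomes a normal crossing after a lift of `F` whose last `n` components are
normal crossings. -/
def ResolvableAlong (F : Ultrafilter (Fin (n + 1) → ℝ)) (g : (Fin (n + 1) → ℝ) → ℝ) : Prop :=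
  ∃ π L, IsLift F π L ∧ IsNormalCrossing (fun y => g (π y)) ∧
    ∀ i : Fin n, IsNormalCrossing fun y => π y i.succ

namespace ResolvableAlong

variable {F : Ultrafilter (Fin (n + 1) → ℝ)} {g g' : (Fin (n + 1) → ℝ) → ℝ}

theorem congr (h : ResolvableAlong F g') (hg : g =ᶠ[𝓝 0] g') : ResolvableAlong F g := by
  obtain ⟨π, L, hπ, hnc, hc⟩ := h
  exact ⟨π, L, hπ, hnc.congr (hπ.tendsto_nhds.eventually hg), hc⟩

theorem of_isNormalCrossing (hF : (F : Filter (Fin (n + 1) → ℝ)) ≤ 𝓝 0)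
    (hg : IsNormalCrossing g) : ResolvableAlong F g :=
  ⟨_, _, .id hF, hg, fun i => .coord i.succ⟩

theorem of_isLift {π L : (Fin (n + 1) → ℝ) → Fin (n + 1) → ℝ} (hπ : IsLift F π L)
    {ρ : (Fin n → ℝ) → Fin n → ℝ} (hρ : ∀ i, IsNormalCrossing fun y => ρ y i)
    (hπρ : ∀ y, Fin.tail (π y) = ρ (Fin.tail y))
    (h : ResolvableAlong (F.map L) fun y => g (π y)) : ResolvableAlong F g := by
  obtain ⟨π', L', hπ', hnc, hc⟩ := h
  refine ⟨_, _, hπ.comp hπ', hnc, fun i => ?_⟩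
  have : ∀ y, π (π' y) i.succ = ρ (Fin.tail (π' y)) i := fun y => congrFun (hπρ (π' y)) i
  simp only [this]
  exact (hρ i).comp hπ'.analyticAt.finTail (by rw [hπ'.map_zero, finTail_zero]) hc

theorem monomialFun_tail_pow_mul (h : ResolvableAlong F g) (β : Fin n → ℕ) (d : ℕ) :
    ResolvableAlong F fun x => monomialFun β (Fin.tail x) ^ d * g x := by
  obtain ⟨π, L, hπ, hnc, hc⟩ := h
  refine ⟨π, L, hπ, IsNormalCrossing.mul (.pow ?_ d) hnc, hc⟩
  refine IsNormalCrossing.comp (f := monomialFun β) ⟨β, 1, analyticAt_const, one_ne_zero, by simp⟩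
    hπ.analyticAt.finTail (by rw [hπ.map_zero, finTail_zero]) hc

end ResolvableAlong

theorem isLift_cons_add {F : Ultrafilter (Fin (n + 1) → ℝ)}
    (hF : (F : Filter (Fin (n + 1) → ℝ)) ≤ 𝓝 0) {φ : (Fin n → ℝ) → ℝ} (hφ : AnalyticAt ℝ φ 0)
    (hφ0 : φ 0 = 0) :
    IsLift F (fun y => Fin.cons (y 0 + φ (Fin.tail y)) (Fin.tail y))
      (fun x => Fin.cons (x 0 - φ (Fin.tail x)) (Fin.tail x)) := by
  have ht : AnalyticAt ℝ (fun x : Fin (n + 1) → ℝ => Fin.tail x) 0 := analyticAt_id.finTail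
  have hφt : AnalyticAt ℝ (fun x : Fin (n + 1) → ℝ => φ (Fin.tail x)) 0 :=
    AnalyticAt.fun_comp (by rwa [finTail_zero]) ht
  refine ⟨((analyticAt_coord 0 0).add hφt).finCons ht, ?_, ?_, .of_forall fun x => ?_⟩
  · simp [finTail_zero, hφ0, finCons_zero_zero]
  · have := (((analyticAt_coord 0 0).sub hφt).finCons ht).continuousAt.tendsto
    simp only [Pi.sub_apply, finTail_zero, hφ0, Pi.zero_apply, sub_zero, finCons_zero_zero] at this
    exact this.mono_left hF
  · simp [Fin.cons_self_tail]

theorem tendsto_finTail : Tendsto (fun x : Fin (n + 1) → ℝ => Fin.tail x) (𝓝 0) (𝓝 0) :=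
  (analyticAt_id.finTail (x := (0 : Fin (n + 1) → ℝ))).continuousAt.tendsto

theorem IsLift.cons {F : Ultrafilter (Fin (n + 1) → ℝ)}
    (hF : (F : Filter (Fin (n + 1) → ℝ)) ≤ 𝓝 0) {π L : (Fin n → ℝ) → Fin n → ℝ}
    (h : IsLift (F.map Fin.tail) π L) :
    IsLift F (fun y => Fin.cons (y 0) (π (Fin.tail y)))
      (fun x => Fin.cons (x 0) (L (Fin.tail x))) := by
  have ht : AnalyticAt ℝ (fun x : Fin (n + 1) → ℝ => Fin.tail x) 0 := analyticAt_id.finTail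
  have hπ := h.analyticAt
  refine ⟨(analyticAt_coord 0 0).finCons (AnalyticAt.fun_comp (by rwa [finTail_zero]) ht), ?_, ?_,
    ?_⟩
  · simp [finTail_zero, h.map_zero, finCons_zero_zero]
  · have hL := h.tendsto
    rw [Ultrafilter.coe_map, tendsto_map'_iff] at hL
    refine tendsto_pi_nhds.2 fun i => ?_
    refine Fin.cases ?_ (fun i => ?_) i
    · simpa using ((continuous_apply 0).tendsto (0 : Fin (n + 1) → ℝ)).mono_left hF
    · simpa using (tendsto_pi_nhds.1 hL) i
  · have := h.eventually_eq
    rw [Ultrafilter.coe_map, Filter.eventually_map] at this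
    filter_upwards [this] with x hx
    simp [hx, Fin.cons_self_tail]

theorem exists_analyticOrderAt_shift_eq {e : ℕ} {c : ℕ → ℝ} {u a : ℝ} (hu : u ≠ 0)
    (hc : ∃ k < e, c k ≠ 0) :
    ∃ d < e + 1, analyticOrderAt (fun t : ℝ =>
      ∑ k ∈ Finset.range e, c k * (t + a) ^ k + (t + a) ^ (e + 1) * u) 0 = d := by
  set Q : ℝ → ℝ := fun t => ∑ k ∈ Finset.range e, c k * t ^ k + t ^ (e + 1) * u with hQ
  have hsum : ∀ x, AnalyticAt ℝ (fun t : ℝ => ∑ k ∈ Finset.range e, c k * t ^ k) x := fun x =>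
    Finset.analyticAt_fun_sum _ fun i _ => by fun_prop
  have hQa : AnalyticAt ℝ (fun t => Q (t + a)) 0 := by
    have : AnalyticAt ℝ Q (0 + a) := (hsum _).add (by fun_prop)
    exact AnalyticAt.fun_comp (f := fun t => t + a) this (by fun_prop)
  have hlt : ¬ ((e + 1 : ℕ) : ℕ∞) ≤ analyticOrderAt (fun t => Q (t + a)) 0 := by
    intro h
    rw [natCast_le_analyticOrderAt_iff_iteratedDeriv_eq_zero hQa] at h
    have h1 := h e (by omega)
    rw [iteratedDeriv_comp_add_const] at h1
    simp only [zero_add] at h1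
    rw [iteratedDeriv_fun_add (hsum a).contDiffAt (AnalyticAt.contDiffAt (by fun_prop)),
      iteratedDeriv_fun_sum fun i hi => AnalyticAt.contDiffAt (by fun_prop)] at h1
    simp only [iteratedDeriv_const_mul_field, iteratedDeriv_mul_const_field,
      iteratedDeriv_pow] at h1
    rw [Finset.sum_eq_zero fun k hk => by
      rw [Nat.descFactorial_of_lt (Finset.mem_range.1 hk)]; simp] at h1
    have ha : a = 0 := by
      have : (e + 1).descFactorial e ≠ 0 := by
        rw [Ne, Nat.descFactorial_eq_zero_iff_lt]; omega
      simpa [this, hu] using h1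
    obtain ⟨k, hk, hck⟩ := hc
    refine hck ?_
    have h2 := iteratedDeriv_eq_of_eventuallyEq_sum (f := fun t => Q (t + a)) (d := e)
      (b := c) (H := fun t => t * u) (by fun_prop)
      (.of_forall fun t => by simp only [hQ, ha, add_zero]; rw [pow_succ, mul_assoc]) hk
    rw [h k (by omega)] at h2
    simpa [Nat.factorial_ne_zero] using h2.symm
  obtain ⟨d, hd⟩ := ENat.ne_top_iff_exists.1 (ne_top_of_lt (not_le.1 hlt))
  refine ⟨d, ?_, hd.symm⟩
  rw [← hd] at hlt
  exact_mod_cast not_le.1 hlt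

theorem resolvableAlong_of_newton_form {e : ℕ}
    (ih : ∀ d < e + 1, ∀ g : (Fin (n + 1) → ℝ) → ℝ, AnalyticAt ℝ g 0 →
      analyticOrderAt (fun t : ℝ => g (Fin.cons t 0)) 0 = d →
      ∀ F : Ultrafilter (Fin (n + 1) → ℝ), (F : Filter (Fin (n + 1) → ℝ)) ≤ 𝓝 0 →
        ResolvableAlong F g)
    {β : Fin n → ℕ} (hβ : β ≠ 0) {c : ℕ → (Fin n → ℝ) → ℝ} {h : (Fin (n + 1) → ℝ) → ℝ}
    (hc : ∀ k < e, AnalyticAt ℝ (c k) 0) (hc0 : ∃ k < e, c k 0 ≠ 0) (hh : AnalyticAt ℝ h 0)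
    (hh0 : h 0 ≠ 0) (F : Ultrafilter (Fin (n + 1) → ℝ))
    (hF : (F : Filter (Fin (n + 1) → ℝ)) ≤ 𝓝 0) :
    ResolvableAlong F fun x => ∑ k ∈ Finset.range e,
      monomialFun β (Fin.tail x) ^ (e + 1 - k) * c k (Fin.tail x) * x 0 ^ k +
        x 0 ^ (e + 1) * h x := by
  have hct : ∀ k < e, ∀ π : (Fin (n + 1) → ℝ) → Fin (n + 1) → ℝ, AnalyticAt ℝ π 0 → π 0 = 0 →
      AnalyticAt ℝ (fun x => c k (Fin.tail (π x))) 0 := fun k hk π hπ hπ0 =>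
    AnalyticAt.fun_comp (by rw [hπ0]; exact hc k hk) hπ.finTail
  by_cases hK : ∃ K : ℝ, ∀ᶠ x : Fin (n + 1) → ℝ in F, |x 0| ≤ K * |monomialFun β (Fin.tail x)|
  · obtain ⟨K, hK⟩ := hK
    obtain ⟨a, ha, h0⟩ := F.exists_tendsto_div hK
    have hm : AnalyticAt ℝ (fun x : Fin (n + 1) → ℝ => monomialFun β (Fin.tail x)) 0 :=
      AnalyticAt.fun_comp (analyticAt_monomialFun β _) analyticAt_id.finTail
    have hm0 : monomialFun β (0 : Fin n → ℝ) = 0 := by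
      obtain ⟨i, hi⟩ := Function.ne_iff.1 hβ
      exact monomialFun_eq_zero hi rfl
    have hlift := isLift_update_mul_add hF (i := 0) hm (by rw [finTail_zero, hm0])
      (fun y s => by rw [Fin.tail_update_zero]) ha h0
    set π : (Fin (n + 1) → ℝ) → Fin (n + 1) → ℝ :=
      fun y => Function.update y 0 (monomialFun β (Fin.tail y) * (y 0 + a)) with hπ
    set g : (Fin (n + 1) → ℝ) → ℝ := fun y => ∑ k ∈ Finset.range e,
      c k (Fin.tail y) * (y 0 + a) ^ k + (y 0 + a) ^ (e + 1) * h (π y) with hg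
    have hga : AnalyticAt ℝ g 0 := by
      have hya : AnalyticAt ℝ (fun y : Fin (n + 1) → ℝ => y 0 + a) 0 :=
        (analyticAt_coord 0 0).add analyticAt_const
      refine (Finset.analyticAt_fun_sum _ fun k hk => ?_).add ((hya.pow _).mul ?_)
      · exact (hct k (Finset.mem_range.1 hk) _ analyticAt_id rfl).mul (hya.pow _)
      · exact AnalyticAt.fun_comp (by rwa [hlift.map_zero]) hlift.analyticAt
    have hgs : ∀ t : ℝ, g (Fin.cons t 0) = ∑ k ∈ Finset.range e, c k 0 * (t + a) ^ k +
        (t + a) ^ (e + 1) * h 0 := by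
      intro t
      have : π (Fin.cons t 0) = 0 := by
        simp [hπ, Fin.tail_cons, hm0, Fin.update_cons_zero, finCons_zero_zero]
      simp only [hg, this, Fin.tail_cons, Fin.cons_zero]
    obtain ⟨d, hd, hord⟩ := exists_analyticOrderAt_shift_eq (c := fun k => c k 0) (a := a) hh0 hc0
    refine .of_isLift hlift (ρ := fun y => y) (.coord) (fun y => by
      rw [hπ, Fin.tail_update_zero]) ?_
    refine ((ih d hd g hga (by simpa only [hgs] using hord) _ hlift.map_le).monomialFun_tail_pow_mul
      β (e + 1)).congr (.of_forall fun y => ?_)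
    have h1 : π y 0 = monomialFun β (Fin.tail y) * (y 0 + a) := by simp [hπ]
    have h2 : Fin.tail (π y) = Fin.tail y := by simp only [hπ, Fin.tail_update_zero]
    simp only [h1, h2, hg]
    rw [mul_add (monomialFun β (Fin.tail y) ^ (e + 1)), Finset.mul_sum]
    refine congrArg₂ _ (Finset.sum_congr rfl fun k hk => ?_) (by rw [mul_pow, mul_assoc])
    obtain ⟨j, hj⟩ : ∃ j, e + 1 = k + j :=
        Nat.exists_eq_add_of_le (Finset.mem_range.1 hk |>.le.trans (Nat.le_succ e))
    rw [hj, Nat.add_sub_cancel_left, mul_pow, pow_add]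
    ring
  · push Not at hK
    obtain ⟨π, L, hπ, hnc, q, hq, hq0, hqe⟩ :=
      exists_isLift_monomialFun_tail_eq_mul_of_lt β F hF hK
    refine ⟨π, L, hπ, ?_, fun i => hnc i.succ⟩
    refine (((hnc 0).pow (e + 1)).mul (.of_ne_zero (f := fun y => ∑ k ∈ Finset.range e,
      q y ^ (e + 1 - k) * c k (Fin.tail (π y)) + h (π y)) ?_ ?_)).congr ?_
    · refine (Finset.analyticAt_fun_sum _ fun k hk => ?_).add ?_
      · exact (hq.pow _).mul (hct k (Finset.mem_range.1 hk) _ hπ.analyticAt hπ.map_zero)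
      · exact AnalyticAt.fun_comp (by rwa [hπ.map_zero]) hπ.analyticAt
    · rw [Finset.sum_eq_zero fun k hk => by
        have := Finset.mem_range.1 hk
        rw [hq0, zero_pow (by omega), zero_mul], hπ.map_zero, zero_add]
      exact hh0
    · filter_upwards [hqe] with y hy
      rw [hy, mul_add, Finset.mul_sum]
      refine congrArg₂ _ (Finset.sum_congr rfl fun k hk => ?_) rfl
      obtain ⟨j, hj⟩ : ∃ j, e + 1 = k + j :=
        Nat.exists_eq_add_of_le (Finset.mem_range.1 hk |>.le.trans (Nat.le_succ e))
      rw [hj, Nat.add_sub_cancel_left, mul_pow, pow_add]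
      ring

theorem Monomializable.resolvableAlong_of_analyticOrderAt_eq (hM : Monomializable n) (d : ℕ) :
    ∀ g : (Fin (n + 1) → ℝ) → ℝ, AnalyticAt ℝ g 0 →
      analyticOrderAt (fun t : ℝ => g (Fin.cons t 0)) 0 = d →
      ∀ F : Ultrafilter (Fin (n + 1) → ℝ), (F : Filter (Fin (n + 1) → ℝ)) ≤ 𝓝 0 →
        ResolvableAlong F g := by
  induction d using Nat.strong_induction_on with
  | _ d ih =>
  intro g hg hd F hF
  rcases d with _ | e
  · refine .of_isNormalCrossing hF (.of_ne_zero hg ?_)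
    have hga : AnalyticAt ℝ (fun t : ℝ => g (Fin.cons t 0)) 0 :=
      AnalyticAt.fun_comp (by rwa [finCons_zero_zero]) (analyticAt_id.finCons analyticAt_const)
    have := hga.analyticOrderAt_eq_zero.1 (by simpa using hd)
    simpa [finCons_zero_zero] using this
  obtain ⟨φ, c, h, hφ, hφ0, hc, hc0, hh, hh0, hgc⟩ := hg.exists_tschirnhaus hd
  have hlift := isLift_cons_add hF hφ hφ0
  refine .of_isLift hlift (ρ := fun y => y) .coord (fun y => Fin.tail_cons _ _) ?_
  refine ResolvableAlong.congr ?_ hgc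
  have hF₁ := hlift.map_le
  generalize F.map _ = F₁ at hF₁ ⊢
  by_cases hz : ∃ k ∈ Finset.range e, ¬ ∀ᶠ x in 𝓝 0, c k x = 0
  · have hF' : (F₁.map Fin.tail : Filter (Fin n → ℝ)) ≤ 𝓝 0 := tendsto_finTail.mono_left hF₁
    obtain ⟨π, L, hπ, hnc, β, c', hβ, hc', hcc', hc'0⟩ :=
      hM.exists_isLift_eq_monomialFun_pow_mul hF' (s := Finset.range e) (fun k _ => hc k)
        (fun k hk => hc0 k (Finset.mem_range.1 hk)) hz (w := fun k => e + 1 - k)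
        (fun k hk => by have := Finset.mem_range.1 hk; omega)
    have hlift' := hπ.cons hF₁
    refine .of_isLift hlift' hnc (fun y => Fin.tail_cons _ _) ?_
    simp only [Fin.tail_cons, Fin.cons_zero]
    refine (resolvableAlong_of_newton_form ih hβ (c := c')
      (h := fun y => h (Fin.cons (y 0) (π (Fin.tail y))))
      (fun k hk => hc' k (Finset.mem_range.2 hk)) (by simpa using hc'0)
      (AnalyticAt.fun_comp (by rwa [hlift'.map_zero]) hlift'.analyticAt)
      (by simpa [hπ.map_zero, finTail_zero, finCons_zero_zero] using hh0) _ hlift'.map_le).congr ?_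
    have := (Finset.eventually_all (Finset.range e)).2 hcc'
    filter_upwards [tendsto_finTail.eventually this] with y hy
    rw [Finset.sum_congr rfl fun k hk => by rw [hy k hk]]
  · push Not at hz
    refine .of_isNormalCrossing hF₁ ((((IsNormalCrossing.coord 0).pow (e + 1)).mul
      (.of_ne_zero hh hh0)).congr ?_)
    have := (Finset.eventually_all (Finset.range e)).2 hz
    filter_upwards [tendsto_finTail.eventually this] with y hy
    rw [Finset.sum_eq_zero fun k hk => by rw [hy k hk, zero_mul], zero_add]

end Regular

section Monomialization

variable {n : ℕ}

theorem AnalyticAt.exists_smul_analyticOrderAt_ne_top {V : Type*} [NormedAddCommGroup V]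
    [NormedSpace ℝ V] {f : V → ℝ} (hf : AnalyticAt ℝ f 0) (h0 : ¬ ∀ᶠ x in 𝓝 0, f x = 0)
    (hf0 : f 0 = 0) : ∃ p ≠ 0, analyticOrderAt (fun t : ℝ => f (t • p)) 0 ≠ ⊤ := by
  obtain ⟨r, hr, hball⟩ := Metric.eventually_nhds_iff_ball.1 hf.eventually_analyticAt
  obtain ⟨p, hp, hpr⟩ := ((not_eventually.1 h0).and_eventually (Metric.ball_mem_nhds 0 hr)).exists
  refine ⟨p, by rintro rfl; exact hp hf0, fun htop => hp ?_⟩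
  have han : AnalyticOnNhd ℝ (fun t : ℝ => f (t • p)) (Icc 0 1) := by
    intro t ht
    refine AnalyticAt.fun_comp (f := fun t : ℝ => t • p) (hball _ ?_) (by fun_prop)
    rw [dist_zero_right] at hpr
    rw [mem_ball_zero_iff]
    rw [norm_smul, Real.norm_of_nonneg ht.1]
    exact (mul_le_of_le_one_left (norm_nonneg p) ht.2).trans_lt hpr
  have := han.eqOn_zero_of_preconnected_of_eventuallyEq_zero isPreconnected_Icc
    (left_mem_Icc.2 zero_le_one) (analyticOrderAt_eq_top.1 htop) (right_mem_Icc.2 zero_le_one)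
  simpa using this

theorem monomializable (n : ℕ) : Monomializable n := by
  induction n with
  | zero =>
    intro f hf h0 F hF
    refine ⟨_, _, .id hF, .of_ne_zero hf fun hf0 => h0 (.of_forall fun x => ?_)⟩
    rwa [Subsingleton.elim x 0]
  | succ n ih =>
    intro f hf h0 F hF
    by_cases hf0 : f 0 = 0
    · obtain ⟨p, hp, hord⟩ := hf.exists_smul_analyticOrderAt_ne_top h0 hf0
      have he : (Fin.cons 1 0 : Fin (n + 1) → ℝ) ≠ 0 := fun h => by
        simpa using congrFun h 0
      obtain ⟨A, hA⟩ := SeparatingDual.exists_continuousLinearEquiv_apply_eq (R := ℝ) he hp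
      have hlift : IsLift F A A.symm :=
        ⟨A.analyticAt 0, map_zero A, (A.symm.continuous.tendsto' 0 0 (map_zero _)).mono_left hF,
          .of_forall A.apply_symm_apply⟩
      obtain ⟨d, hd⟩ := ENat.ne_top_iff_exists.1 hord
      obtain ⟨π, L, hπ, hnc, -⟩ := ih.resolvableAlong_of_analyticOrderAt_eq d (fun x => f (A x))
        (AnalyticAt.fun_comp (by rwa [map_zero]) (A.analyticAt 0)) (by
          rw [hd]
          congr 1
          ext t
          rw [← hA, ← map_smul]
          congr 2
          ext i
          refine Fin.cases ?_ (fun i => ?_) i <;> simp) _ hlift.map_le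
      exact ⟨_, _, hlift.comp hπ, hnc⟩
    · exact ⟨_, _, .id hF, .of_ne_zero hf hf0⟩

end Monomialization

section Gradient

variable {n : ℕ}

theorem mul_deriv_monomialFun_update (α : Fin n → ℕ) (y : Fin n → ℝ) (i : Fin n) :
    ∃ D, HasDerivAt (fun s => monomialFun α (Function.update y i s)) D (y i) ∧
      y i * D = α i * monomialFun α y := by
  have h : ∀ s, monomialFun α (Function.update y i s) =
      s ^ α i * ∏ j ∈ Finset.univ.erase i, y j ^ α j := by
    intro s
    rw [monomialFun, ← Finset.mul_prod_erase _ _ (Finset.mem_univ i), Function.update_self]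
    congr 1
    exact Finset.prod_congr rfl fun j hj => by
      rw [Function.update_of_ne (Finset.ne_of_mem_erase hj)]
  refine ⟨α i * y i ^ (α i - 1) * ∏ j ∈ Finset.univ.erase i, y j ^ α j, ?_, ?_⟩
  · simp only [h]
    exact (hasDerivAt_pow _ _).mul_const _
  · have := h (y i)
    rw [Function.update_eq_self] at this
    rw [this]
    rcases hα : α i with _ | k
    · simp
    · rw [Nat.add_sub_cancel, pow_succ]; ring

theorem mul_fderiv_monomialFun_mul {α : Fin n → ℕ} {u g : (Fin n → ℝ) → ℝ} {y : Fin n → ℝ}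
    (hu : DifferentiableAt ℝ u y) (hg : g =ᶠ[𝓝 y] fun x => monomialFun α x * u x) (i : Fin n) :
    y i * fderiv ℝ g y (Pi.single i 1) =
      monomialFun α y * (α i * u y + y i * fderiv ℝ u y (Pi.single i 1)) := by
  obtain ⟨D, hD, hyD⟩ := mul_deriv_monomialFun_update α y i
  have hupd : HasDerivAt (Function.update y i) (Pi.single i 1) (y i) := hasDerivAt_update y i (y i)
  have hm : DifferentiableAt ℝ (monomialFun α) y := (analyticAt_monomialFun α y).differentiableAt
  have h1 : HasDerivAt (fun s => monomialFun α (Function.update y i s))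
      (fderiv ℝ (monomialFun α) y (Pi.single i 1)) (y i) :=
    HasFDerivAt.comp_hasDerivAt (f := Function.update y i) (l := monomialFun α)
      (l' := fderiv ℝ (monomialFun α) y) (y i)
      (by rw [Function.update_eq_self]; exact hm.hasFDerivAt) hupd
  rw [hg.fderiv_eq, fderiv_fun_mul hm hu]
  simp only [add_apply, smul_apply, smul_eq_mul]
  rw [h1.unique hD]
  linear_combination u y * hyD

theorem exists_abs_pow_le_abs_monomialFun {α : Fin n → ℕ} (hα : α ≠ 0) {y : Fin n → ℝ}
    (hy : ‖y‖ ≤ 1) : ∃ i, α i ≠ 0 ∧ |y i| ^ (∑ j, α j + 2) ≤ |monomialFun α y| := by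
  obtain ⟨i₀, hi₀⟩ := Function.ne_iff.1 hα
  obtain ⟨i, hi, hmin⟩ := Finset.exists_min_image (Finset.univ.filter fun i => α i ≠ 0)
    (fun i => |y i|) ⟨i₀, by simpa using hi₀⟩
  have hi' : α i ≠ 0 := by simpa using hi
  refine ⟨i, hi', ?_⟩
  have h1 : |y i| ≤ 1 := (norm_le_pi_norm y i).trans hy
  calc |y i| ^ (∑ j, α j + 2) ≤ |y i| ^ (∑ j, α j) :=
        pow_le_pow_of_le_one (abs_nonneg _) h1 (by omega)
    _ = ∏ j, |y i| ^ α j := (Finset.prod_pow_eq_pow_sum _ _ _).symm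
    _ ≤ ∏ j, |y j| ^ α j := by
        refine Finset.prod_le_prod (fun j _ => by positivity) fun j _ => ?_
        by_cases hj : α j = 0
        · simp [hj]
        · exact pow_le_pow_left₀ (abs_nonneg _) (hmin j (by simpa using hj)) _
    _ = |monomialFun α y| := by simp [monomialFun, Finset.abs_prod, abs_pow]

theorem rpow_one_sub_mul_le {m t : ℝ} (hm : 0 < m) (ht : 0 ≤ t) {N : ℕ} (hN : N ≠ 0)
    (h : t ^ N ≤ m) : m ^ (1 - 1 / N : ℝ) * t ≤ m := by
  have h1 : t ≤ m ^ (1 / N : ℝ) := by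
    rw [← Real.pow_rpow_inv_natCast ht hN, ← one_div]
    exact Real.rpow_le_rpow (by positivity) h (by positivity)
  calc m ^ (1 - 1 / N : ℝ) * t ≤ m ^ (1 - 1 / N : ℝ) * m ^ (1 / N : ℝ) := by gcongr
    _ = m := by rw [← Real.rpow_add hm]; simp

theorem IsNormalCrossing.exists_rpow_le_norm_fderiv {g : (Fin n → ℝ) → ℝ}
    (hg : IsNormalCrossing g) (hg0 : g 0 = 0) :
    ∃ (k : ℕ) (C : ℝ), ∀ᶠ y in 𝓝 0, |g y| ^ (1 - 1 / (k + 2 : ℕ) : ℝ) ≤ C * ‖fderiv ℝ g y‖ := by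
  obtain ⟨α, u, hu, hu0, hgu⟩ := hg
  have hα : α ≠ 0 := by
    rintro rfl
    have := hgu.self_of_nhds
    rw [hg0, monomialFun_zero, one_mul] at this
    exact hu0 this.symm
  set N := ∑ j, α j + 2 with hN
  set B := ‖fderiv ℝ u 0‖ + 1 with hB
  have hBpos : 0 < B := by positivity
  have hu0' : 0 < |u 0| := abs_pos.2 hu0
  have ev1 : ∀ᶠ y : Fin n → ℝ in 𝓝 0, ‖y‖ < min 1 (|u 0| / (4 * B)) := by
    have : 0 < min 1 (|u 0| / (4 * B)) := by positivity
    filter_upwards [Metric.ball_mem_nhds (0 : Fin n → ℝ) this] with y hy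
    rwa [mem_ball_zero_iff] at hy
  have ev2 : ∀ᶠ y in 𝓝 0, ‖fderiv ℝ u y‖ < B :=
    hu.fderiv.continuousAt.norm.eventually_lt_const (by simp [hB])
  have ev3 : ∀ᶠ y in 𝓝 0, |u 0| / 2 < |u y| :=
    hu.continuousAt.abs.eventually_const_lt (by linarith)
  have ev4 : ∀ᶠ y in 𝓝 0, |u y| < |u 0| + 1 :=
    hu.continuousAt.abs.eventually_lt_const (by linarith)
  refine ⟨∑ j, α j, (|u 0| + 1) * (4 / |u 0|), ?_⟩
  filter_upwards [ev1, ev2, ev3, ev4, hgu.eventually_nhds, hu.eventually_analyticAt]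
    with y h1 h2 h3 h4 h5 h6
  have hN1 : (0 : ℝ) < 1 - 1 / (N : ℕ) := by
    have : (2 : ℝ) ≤ N := by exact_mod_cast (by omega : 2 ≤ N)
    rw [sub_pos, div_lt_one] <;> linarith
  obtain ⟨i, hi, hle⟩ := exists_abs_pow_le_abs_monomialFun hα (h1.le.trans (min_le_left _ _))
  have hgy : g y = monomialFun α y * u y := h5.self_of_nhds
  by_cases hm : monomialFun α y = 0
  · rw [hgy, hm, zero_mul, abs_zero, Real.zero_rpow hN1.ne']
    positivity
  have hm' : 0 < |monomialFun α y| := abs_pos.2 hm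
  have hyi : 0 < |y i| := abs_pos.2 fun h => hm (monomialFun_eq_zero hi h)
  have hyi' : |y i| ≤ |u 0| / (4 * B) := (norm_le_pi_norm y i).trans (h1.le.trans (min_le_right _ _))
  have key := mul_fderiv_monomialFun_mul h6.differentiableAt h5 i
  have hsingle : ‖(Pi.single i 1 : Fin n → ℝ)‖ ≤ 1 := by rw [Pi.norm_single, norm_one]
  have hdu : |y i * fderiv ℝ u y (Pi.single i 1)| ≤ |u 0| / 4 := by
    rw [abs_mul]
    calc |y i| * |fderiv ℝ u y (Pi.single i 1)| ≤ |u 0| / (4 * B) * B := by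
          gcongr
          exact ((fderiv ℝ u y).unit_le_opNorm _ hsingle).trans h2.le
      _ = |u 0| / 4 := by field_simp
  have hsum : |u 0| / 4 ≤ |α i * u y + y i * fderiv ℝ u y (Pi.single i 1)| := by
    have hαi : (1 : ℝ) ≤ α i := by exact_mod_cast Nat.one_le_iff_ne_zero.2 hi
    have := abs_sub_abs_le_abs_sub (α i * u y) (-(y i * fderiv ℝ u y (Pi.single i 1)))
    rw [abs_neg, sub_neg_eq_add, abs_mul, Nat.abs_cast] at this
    nlinarith [abs_nonneg (u y)]
  have hfd : |monomialFun α y| * (|u 0| / 4) ≤ |y i| * ‖fderiv ℝ g y‖ := by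
    calc |monomialFun α y| * (|u 0| / 4) ≤
          |monomialFun α y * (α i * u y + y i * fderiv ℝ u y (Pi.single i 1))| := by
          rw [abs_mul]; gcongr
      _ = |y i| * |fderiv ℝ g y (Pi.single i 1)| := by rw [← key, abs_mul]
      _ ≤ _ := by gcongr; exact (fderiv ℝ g y).unit_le_opNorm _ hsingle
  have hrp : |monomialFun α y| ^ (1 - 1 / (N : ℕ) : ℝ) ≤ 4 / |u 0| * ‖fderiv ℝ g y‖ := by
    have := rpow_one_sub_mul_le hm' hyi.le (by omega : N ≠ 0) hle
    refine le_of_mul_le_mul_right (this.trans ?_) hyi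
    have h7 := mul_le_mul_of_nonneg_left hfd (by positivity : 0 ≤ 4 / |u 0|)
    calc |monomialFun α y| = 4 / |u 0| * (|monomialFun α y| * (|u 0| / 4)) := by field_simp
      _ ≤ _ := h7
      _ = _ := by ring
  have hup : |u y| ^ (1 - 1 / (N : ℕ) : ℝ) ≤ |u 0| + 1 := by
    refine (Real.rpow_le_rpow (abs_nonneg _) h4.le hN1.le).trans ?_
    refine Real.rpow_le_self_of_one_le (by linarith) ?_
    have : (0 : ℝ) ≤ 1 / (N : ℕ) := by positivity
    linarith
  rw [hgy, abs_mul, Real.mul_rpow (abs_nonneg _) (abs_nonneg _), mul_comm, mul_assoc]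
  exact mul_le_mul hup hrp (by positivity) (by positivity)

theorem AnalyticAt.exists_norm_fderiv_comp_le {V W G : Type*} [NormedAddCommGroup V]
    [NormedSpace ℝ V] [CompleteSpace V] [NormedAddCommGroup W] [NormedSpace ℝ W] [CompleteSpace W]
    [NormedAddCommGroup G] [NormedSpace ℝ G] [CompleteSpace G] {f : W → G} {π : V → W} {x : V}
    (hf : AnalyticAt ℝ f (π x)) (hπ : AnalyticAt ℝ π x) :
    ∃ K > (0 : ℝ), ∀ᶠ y in 𝓝 x, ‖fderiv ℝ (fun y => f (π y)) y‖ ≤ K * ‖fderiv ℝ f (π y)‖ := by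
  refine ⟨‖fderiv ℝ π x‖ + 1, by positivity, ?_⟩
  filter_upwards [hπ.fderiv.continuousAt.norm.eventually_lt_const (lt_add_one _),
    hπ.continuousAt.eventually hf.eventually_analyticAt, hπ.eventually_analyticAt] with y h1 h2 h3
  rw [fderiv_fun_comp y h2.differentiableAt h3.differentiableAt, mul_comm]
  exact (ContinuousLinearMap.opNorm_comp_le _ _).trans (by gcongr)

theorem Filter.exists_mem_of_forall_ultrafilter {X : Type*} {l : Filter X} {S : ℕ → Set X}
    (hS : Monotone S) (h : ∀ F : Ultrafilter X, (F : Filter X) ≤ l → ∃ k, S k ∈ F) :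
    ∃ k, S k ∈ l := by
  by_contra! hl
  have hne : ∀ k, NeBot (l ⊓ 𝓟 (S k)ᶜ) := fun k => by
    rw [neBot_iff, Ne, inf_principal_eq_bot, compl_compl]
    exact hl k
  have : NeBot (⨅ k, l ⊓ 𝓟 (S k)ᶜ) := by
    refine iInf_neBot_of_directed' (directed_of_isDirected_le fun i j hij => ?_) hne
    exact inf_le_inf_left l (principal_mono.2 (compl_subset_compl.2 (hS hij)))
  have hle : ∀ k, (Ultrafilter.of (⨅ k, l ⊓ 𝓟 (S k)ᶜ) : Filter X) ≤ l ⊓ 𝓟 (S k)ᶜ :=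
    fun k => (Ultrafilter.of_le _).trans (iInf_le _ k)
  obtain ⟨k, hk⟩ := h _ ((hle 0).trans inf_le_left)
  exact Ultrafilter.compl_mem_iff_notMem.1 (le_principal_iff.1 ((hle k).trans inf_le_right)) hk

theorem AnalyticAt.exists_rpow_le_norm_fderiv {f : (Fin n → ℝ) → ℝ} (hf : AnalyticAt ℝ f 0)
    (hf0 : f 0 = 0) :
    ∃ (k : ℕ), ∀ᶠ x in 𝓝 0, |f x| ^ (1 - 1 / (k + 2) : ℝ) ≤ (k + 1) * ‖fderiv ℝ f x‖ := by
  have hexp : ∀ k : ℕ, (0 : ℝ) < 1 - 1 / (k + 2) := fun k => by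
    rw [sub_pos, div_lt_one (by positivity)]
    linarith [k.cast_nonneg (α := ℝ)]
  by_cases hz : ∀ᶠ x in 𝓝 0, f x = 0
  · refine ⟨0, hz.mono fun x hx => ?_⟩
    rw [hx, abs_zero, Real.zero_rpow (hexp 0).ne']
    positivity
  set S : ℕ → Set (Fin n → ℝ) := fun k =>
    {x | |f x| ≤ 1 → |f x| ^ (1 - 1 / (k + 2) : ℝ) ≤ (k + 1) * ‖fderiv ℝ f x‖} with hS
  have hmono : Monotone S := fun j k hjk x hx h1 => by
    have hjk' : (j : ℝ) ≤ k := by exact_mod_cast hjk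
    calc |f x| ^ (1 - 1 / (k + 2) : ℝ) ≤ |f x| ^ (1 - 1 / (j + 2) : ℝ) := by
          refine Real.rpow_le_rpow_of_exponent_ge' (abs_nonneg _) h1 (hexp j).le ?_
          gcongr
      _ ≤ (j + 1) * ‖fderiv ℝ f x‖ := hx h1
      _ ≤ (k + 1) * ‖fderiv ℝ f x‖ := by gcongr
  have hle1 : ∀ᶠ x in 𝓝 0, |f x| < 1 :=
    hf.continuousAt.abs.eventually_lt_const (by simp [hf0])
  obtain ⟨k, hk⟩ : ∃ k, S k ∈ 𝓝 0 := by
    refine exists_mem_of_forall_ultrafilter hmono fun F hF => ?_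
    obtain ⟨π, L, hπ, hnc⟩ := monomializable n f hf hz F hF
    obtain ⟨k, C, hC⟩ := hnc.exists_rpow_le_norm_fderiv (by rw [hπ.map_zero, hf0])
    obtain ⟨K, hK, hKb⟩ := AnalyticAt.exists_norm_fderiv_comp_le (f := f) (π := π)
      (by rwa [hπ.map_zero]) hπ.analyticAt
    obtain ⟨j, hj⟩ := exists_nat_ge (max 0 C * K)
    refine ⟨max k j, ?_⟩
    filter_upwards [hπ.tendsto.eventually hC, hπ.tendsto.eventually hKb, hπ.eventually_eq]
      with x h1 h2 h3 h4
    rw [h3] at h1 h2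
    have hkm : (k : ℝ) ≤ (max k j : ℕ) := by exact_mod_cast le_max_left k j
    have hjm : (j : ℝ) ≤ (max k j : ℕ) := by exact_mod_cast le_max_right k j
    calc |f x| ^ (1 - 1 / ((max k j : ℕ) + 2) : ℝ) ≤ |f x| ^ (1 - 1 / (k + 2 : ℕ) : ℝ) := by
          push_cast
          push_cast at hkm
          refine Real.rpow_le_rpow_of_exponent_ge' (abs_nonneg _) h4 (hexp k).le ?_
          gcongr
      _ ≤ C * ‖fderiv ℝ (fun y => f (π y)) (L x)‖ := h1
      _ ≤ max 0 C * (K * ‖fderiv ℝ f x‖) := by gcongr; exact le_max_right _ _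
      _ = max 0 C * K * ‖fderiv ℝ f x‖ := by ring
      _ ≤ _ := by gcongr; linarith
  exact ⟨k, by filter_upwards [hk, hle1] with x h1 h2 using h1 h2.le⟩

end Gradient

/-- Łojasiewicz gradient inequality (Lemma 1.5): if `E : ℝⁿ → ℝ` is real-analytic in a
neighborhood of `0` with `E 0 = 0` and `∇E 0 = 0`, then there exist `θ ∈ (0, 1/2]`, `C > 0`
and `r > 0` such that `|E x| ^ (1 - θ) ≤ C * ‖∇E x‖` for `‖x‖ < r`. -/
theorem lojasiewicz_gradient_inequality
    (n : ℕ) (hn : 1 ≤ n) (E : EuclideanSpace ℝ (Fin n) → ℝ)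
    (s : Set (EuclideanSpace ℝ (Fin n))) (hs : IsOpen s) (h0s : (0 : EuclideanSpace ℝ (Fin n)) ∈ s)
    (hE : AnalyticOnNhd ℝ E s)
    (hE0 : E 0 = 0) (hgrad0 : gradient E 0 = 0) :
    ∃ θ ∈ Ioc (0 : ℝ) (1 / 2), ∃ C > (0 : ℝ), ∃ r > (0 : ℝ),
      ∀ x : EuclideanSpace ℝ (Fin n), ‖x‖ < r →
        |E x| ^ (1 - θ) ≤ C * ‖gradient E x‖ := by
  set e := EuclideanSpace.equiv (Fin n) ℝ
  have hEe : AnalyticAt ℝ E (e.symm 0) := by rw [map_zero]; exact hE 0 h0s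
  have hf : AnalyticAt ℝ (fun y => E (e.symm y)) 0 := AnalyticAt.fun_comp hEe (e.symm.analyticAt 0)
  obtain ⟨k, hk⟩ := hf.exists_rpow_le_norm_fderiv (by rw [map_zero, hE0])
  obtain ⟨K, hK, hKb⟩ := hEe.exists_norm_fderiv_comp_le (e.symm.analyticAt 0)
  have he : Tendsto e (𝓝 0) (𝓝 0) := e.continuous.tendsto' 0 0 (map_zero e)
  obtain ⟨r, hr, hball⟩ :=
    Metric.eventually_nhds_iff_ball.1 ((he.eventually hk).and (he.eventually hKb))
  refine ⟨1 / (k + 2), ⟨by positivity, ?_⟩, (k + 1) * K, by positivity, r, hr, fun x hx => ?_⟩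
  · gcongr
    linarith [k.cast_nonneg (α := ℝ)]
  · obtain ⟨h1, h2⟩ := hball x (by simpa using hx)
    rw [e.symm_apply_apply] at h1 h2
    have hgrad : ‖gradient E x‖ = ‖fderiv ℝ E x‖ := by
      rw [gradient, LinearIsometryEquiv.norm_map]
    rw [hgrad, mul_assoc]
    exact h1.trans (by gcongr)
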